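/- arXiv:1407.7007 — 3 statements merged into one kernel-verified Lean document; each statement's English description precedes it below -/
import Mathlib

section
/- Let A = {d_1, …, d_n} be a generalized arithmetic sequence of positive integers with n ≥ 3, gcd(d_1, …, d_n) = 1, and such that A minimally generates the numerical semigroup ℕd_1 + … + ℕd_n (equivalently, n ≤ d_1). Then the toric ideal I_A is a complete intersection if and only if n = 3 and d_1 is even. -/
open MvPolynomial

/-- The `(p,q)`-Fibonacci sequence: `F 0 = 0`, `F 1 = 1`, `F (n+2) = p * F (n+1) + q * F n`. -/
def pqFib (p q : ℕ) : ℕ → ℕ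
  | 0 => 0
  | 1 => 1
  | n + 2 => p * pqFib p q (n + 1) + q * pqFib p q n

/-- The `(p,q)`-Lucas sequence: `L 0 = 2`, `L 1 = p`, `L (n+2) = p * L (n+1) + q * L n`. -/
def pqLucas (p q : ℕ) : ℕ → ℕ
  | 0 => 2
  | 1 => p
  | n + 2 => p * pqLucas p q (n + 1) + q * pqLucas p q n

/-- The toric ideal of the affine monomial curve `t ↦ (t^{d 0}, …, t^{d (n-1)})`:
the kernel of the `k`-algebra map `k[x_1,…,x_n] → k[t]`, `x_i ↦ t^{d i}`. -/
noncomputable def toricIdeal (k : Type*) [Field k] {n : ℕ} (d : Fin n → ℕ) :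
    Ideal (MvPolynomial (Fin n) k) :=
  RingHom.ker (MvPolynomial.aeval
    (fun i : Fin n => (Polynomial.X : Polynomial k) ^ d i)).toRingHom

/-- The toric ideal `I_A` is a complete intersection iff it can be generated by
`n - 1` elements. -/
def IsCI (k : Type*) [Field k] {n : ℕ} (d : Fin n → ℕ) : Prop :=
  ∃ g : Fin (n - 1) → MvPolynomial (Fin n) k,
    Ideal.span (Set.range g) = toricIdeal k d

/-- The toric ideal of the projective monomial curve: the kernel of the `k`-algebra map
`k[x_1,…,x_{n+1}] → k[t,u]`, `x_i ↦ t^{d i} u^{D - d i}` for `i ≤ n` and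
`x_{n+1} ↦ u^D`, where `D = max A`. -/
noncomputable def projToricIdeal (k : Type*) [Field k] {n : ℕ} (d : Fin n → ℕ) :
    Ideal (MvPolynomial (Fin (n + 1)) k) :=
  RingHom.ker (MvPolynomial.aeval (fun i : Fin (n + 1) =>
    if h : (i : ℕ) < n then
      (X 0 : MvPolynomial (Fin 2) k) ^ d ⟨i, h⟩ *
        (X 1 : MvPolynomial (Fin 2) k) ^ (Finset.univ.sup d - d ⟨i, h⟩)
    else (X 1 : MvPolynomial (Fin 2) k) ^ (Finset.univ.sup d))).toRingHom

/-- The projective toric ideal `I_{A*}` is a complete intersection iff it can be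
generated by `n - 1` elements. -/
def ProjIsCI (k : Type*) [Field k] {n : ℕ} (d : Fin n → ℕ) : Prop :=
  ∃ g : Fin (n - 1) → MvPolynomial (Fin (n + 1)) k,
    Ideal.span (Set.range g) = projToricIdeal k d

/-- `d 0 < d 1 < ⋯` is a generalized arithmetic sequence: there are positive
integers `h, e` with `d i = h * d 0 + i * e` for every `i ≥ 1`. -/
def IsGenArith {n : ℕ} (d : Fin n → ℕ) : Prop :=
  ∃ h e : ℕ, 0 < h ∧ 0 < e ∧
    ∀ i : Fin n, 0 < (i : ℕ) → d i = h * d ⟨0, i.pos⟩ + (i : ℕ) * e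

/-- `d 0 < d 1 < ⋯` is an increasing arithmetic sequence: there is a positive
integer `e` with `d i = d 0 + i * e` for every `i`. -/
def IsArithFn {n : ℕ} (d : Fin n → ℕ) : Prop :=
  ∃ e : ℕ, 0 < e ∧ ∀ i : Fin n, 0 < (i : ℕ) → d i = d ⟨0, i.pos⟩ + (i : ℕ) * e

/-- `A = {d 0, …, d (n-1)}` minimally generates the numerical semigroup
`ℕ d 0 + ⋯ + ℕ d (n-1)`: no `d i` lies in the subsemigroup generated by the rest. -/
def MinimallyGenerates {n : ℕ} (d : Fin n → ℕ) : Prop :=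
  ∀ i : Fin n, ¬ ∃ α : Fin n → ℕ, α i = 0 ∧ d i = ∑ j, α j * d j


def wt0 {n : ℕ} (d : Fin n → ℕ) (u : Fin n →₀ ℕ) : ℕ := ∑ i, u i * d i

lemma wt0_add {n : ℕ} (d : Fin n → ℕ) (u v : Fin n →₀ ℕ) :
    wt0 d (u + v) = wt0 d u + wt0 d v := by
  simp [wt0, add_mul, Finset.sum_add_distrib]

lemma wt0_single {n : ℕ} (d : Fin n → ℕ) (i : Fin n) (c : ℕ) :
    wt0 d (Finsupp.single i c) = c * d i := by
  classical
  simp [wt0, Finsupp.single_apply, ite_mul]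

lemma aeval_mono {k : Type*} [Field k] {n : ℕ} (d : Fin n → ℕ) (u : Fin n →₀ ℕ) (c : k) :
    MvPolynomial.aeval (fun i : Fin n => (Polynomial.X : Polynomial k) ^ d i)
      (monomial u c) = Polynomial.C c * Polynomial.X ^ (wt0 d u) := by
  rw [MvPolynomial.aeval_monomial, wt0, ← Finset.prod_pow_eq_pow_sum]
  rw [Finsupp.prod_fintype _ _ (by simp)]
  congr 1
  apply Finset.prod_congr rfl
  intro i _
  rw [← pow_mul, mul_comm]

lemma mem_toric {k : Type*} [Field k] {n : ℕ} {d : Fin n → ℕ} (f : MvPolynomial (Fin n) k) :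
    f ∈ toricIdeal k d ↔
      MvPolynomial.aeval (fun i : Fin n => (Polynomial.X : Polynomial k) ^ d i) f = 0 := by
  rfl

lemma coeff_zero_of_unique {k : Type*} [Field k] {n : ℕ} {d : Fin n → ℕ}
    {f : MvPolynomial (Fin n) k} (hf : f ∈ toricIdeal k d) (w : Fin n →₀ ℕ)
    (hw : ∀ v ∈ f.support, wt0 d v = wt0 d w → v = w) : coeff w f = 0 := by
  classical
  rw [mem_toric] at hf
  have h1 := congrArg (fun p => Polynomial.coeff p (wt0 d w)) hf
  simp only [Polynomial.coeff_zero] at h1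
  rw [f.as_sum, map_sum, Polynomial.finsetSum_coeff] at h1
  simp only [aeval_mono, Polynomial.coeff_C_mul, Polynomial.coeff_X_pow] at h1
  by_contra hne
  have hmem : w ∈ f.support := by rwa [mem_support_iff]
  rw [Finset.sum_eq_single w] at h1
  · simp at h1; exact hne h1
  · intro b hb hbw
    rw [if_neg, mul_zero]
    intro h; exact hbw (hw b hb h.symm)
  · intro h; exact absurd hmem h

lemma binom_mem {k : Type*} [Field k] {n : ℕ} {d : Fin n → ℕ}
    (u v : Fin n →₀ ℕ) (h : wt0 d u = wt0 d v) :
    (monomial u 1 - monomial v 1 : MvPolynomial (Fin n) k) ∈ toricIdeal k d := by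
  rw [mem_toric, map_sub, aeval_mono, aeval_mono, h, sub_self]

def Isol {n : ℕ} (d : Fin n → ℕ) (u : Fin n →₀ ℕ) : Prop :=
  ∀ i, u i ≠ 0 → ∀ v, wt0 d v = wt0 d (u - Finsupp.single i 1) → v = u - Finsupp.single i 1

lemma coeff_mul_isol {k : Type*} [Field k] {n : ℕ} {d : Fin n → ℕ} {u : Fin n →₀ ℕ}
    (hu : Isol d u) (p g : MvPolynomial (Fin n) k) (hg : g ∈ toricIdeal k d) :
    coeff u (p * g) = constantCoeff p * coeff u g := by
  classical
  induction p using MvPolynomial.induction_on with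
  | C a => simp
  | add p q hp hq => simp [add_mul, hp, hq]
  | mul_X p i hp =>
    have : p * X i * g = (p * g) * X i := by ring
    rw [this, coeff_mul_X']
    split_ifs with h
    · rw [coeff_zero_of_unique (d := d) (Ideal.mul_mem_left _ p hg)]
      · simp
      · intro v _ hv
        exact hu i (by simpa using h) v hv
    · simp

lemma not_CI {k : Type*} [Field k] {n : ℕ} {d : Fin n → ℕ} (hn : 0 < n) (h : IsCI k d)
    (T P : Fin n → (Fin n →₀ ℕ)) (hT : Function.Injective T) (hI : ∀ i, Isol d (T i))
    (hw : ∀ i, wt0 d (T i) = wt0 d (P i)) (hP : ∀ i j, P i ≠ T j) : False := by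
  classical
  obtain ⟨g, hg⟩ := h
  have hgm : ∀ j, g j ∈ toricIdeal k d := fun j => by
    rw [← hg]; exact Ideal.subset_span ⟨j, rfl⟩
  let Φ : MvPolynomial (Fin n) k → (Fin n → k) := fun f i => coeff (T i) f
  have hspan : ∀ f ∈ toricIdeal k d, Φ f ∈ Submodule.span k (Set.range fun j => Φ (g j)) := by
    intro f hf
    rw [← hg, Ideal.mem_span_range_iff_exists_fun] at hf
    obtain ⟨c, rfl⟩ := hf
    have : Φ (∑ i, c i * g i) = ∑ i, constantCoeff (c i) • Φ (g i) := by
      ext t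
      simp only [Φ, coeff_sum, Finset.sum_apply, Pi.smul_apply, smul_eq_mul]
      exact Finset.sum_congr rfl fun j _ => coeff_mul_isol (hI t) _ _ (hgm j)
    rw [this]
    exact Submodule.sum_mem _ fun j _ => Submodule.smul_mem _ _ (Submodule.subset_span ⟨j, rfl⟩)
  have htop : Submodule.span k (Set.range fun j => Φ (g j)) = ⊤ := by
    rw [eq_top_iff, ← (Pi.basisFun k (Fin n)).span_eq, Submodule.span_le]
    rintro _ ⟨i, rfl⟩
    have := hspan _ (binom_mem (k := k) _ _ (hw i))
    have heq : Pi.basisFun k (Fin n) i = Φ (monomial (T i) 1 - monomial (P i) 1) := by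
      ext t
      simp only [Pi.basisFun_apply, Φ, coeff_sub, coeff_monomial, if_neg (hP i t), sub_zero,
        hT.eq_iff, Pi.single_apply]
      simp only [eq_comm]
    rw [heq]; exact this
  have h1 := finrank_range_le_card (R := k) (fun j => Φ (g j))
  rw [Set.finrank, htop, finrank_top] at h1
  simp at h1
  omega

lemma isol_pair {n : ℕ} {d : Fin n → ℕ} (hpos : ∀ i, 0 < d i) (hmin : MinimallyGenerates d)
    (i j : Fin n) : Isol d (Finsupp.single i 1 + Finsupp.single j 1) := by
  classical
  have key : ∀ (j : Fin n) (v : Fin n →₀ ℕ), wt0 d v = wt0 d (Finsupp.single j 1) →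
      v = Finsupp.single j 1 := by
    intro j v hv
    by_cases h0 : v j = 0
    · exfalso
      apply hmin j
      refine ⟨v, h0, ?_⟩
      rw [wt0_single, one_mul] at hv
      exact hv.symm
    · have hle : Finsupp.single j 1 ≤ v := by
        rw [Finsupp.single_le_iff]; omega
      obtain ⟨w, rfl⟩ := exists_add_of_le hle
      rw [wt0_add] at hv
      have hw : wt0 d w = 0 := by omega
      have : w = 0 := by
        ext t
        rw [wt0, Finset.sum_eq_zero_iff] at hw
        have := hw t (Finset.mem_univ _)
        have := hpos t
        rcases Nat.mul_eq_zero.1 (hw t (Finset.mem_univ _)) with h | h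
        · exact h
        · omega
      simp [this]
  intro t ht v hv
  have : t = i ∨ t = j := by
    by_contra hc
    push Not at hc
    apply ht
    simp [Finsupp.single_apply, hc.1.symm, hc.2.symm]
  rcases this with rfl | rfl
  · rw [add_tsub_cancel_left] at *; exact key _ _ hv
  · rw [add_tsub_cancel_right] at *; exact key _ _ hv

lemma wt0_ga {m : ℕ} {d : Fin (m+1) → ℕ} {a h e : ℕ} (h0 : d 0 = a)
    (hd : ∀ i : Fin m, d i.succ = h * a + (i + 1) * e) (v : Fin (m+1) →₀ ℕ) :
    ∃ D S : ℕ, wt0 d v = v 0 * a + D * h * a + S * e ∧ D ≤ S ∧ S ≤ m * D ∧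
      (D = 0 → v = Finsupp.single 0 (v 0)) ∧ (S = m * D → ∀ i : Fin m, (i : ℕ) + 1 < m → v i.succ = 0) := by
  refine ⟨∑ i : Fin m, v i.succ, ∑ i : Fin m, v i.succ * (i + 1), ?_, ?_, ?_, ?_, ?_⟩
  · rw [wt0, Fin.sum_univ_succ, h0, add_assoc]
    congr 1
    simp only [Finset.sum_mul, ← Finset.sum_add_distrib]
    refine Finset.sum_congr rfl fun i _ => ?_
    rw [hd]; ring
  · exact Finset.sum_le_sum fun i _ => Nat.le_mul_of_pos_right _ (by omega)
  · rw [Finset.mul_sum]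
    refine Finset.sum_le_sum fun i _ => ?_
    rw [mul_comm]; exact Nat.mul_le_mul_right _ i.2
  · intro hD
    rw [Finset.sum_eq_zero_iff] at hD
    ext t
    refine Fin.cases ?_ (fun i => ?_) t
    · simp
    · simp [hD i (Finset.mem_univ _), Finsupp.single_apply, (Fin.succ_ne_zero i).symm]
  · intro hS i hi
    rw [Finset.mul_sum, Finset.sum_eq_sum_iff_of_le] at hS
    · have := hS i (Finset.mem_univ _)
      rw [mul_comm] at this
      by_contra hne
      have := Nat.eq_of_mul_eq_mul_right (Nat.pos_of_ne_zero hne) this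
      omega
    · intro i _
      rw [mul_comm]; exact Nat.mul_le_mul_right _ i.2

lemma isol_zero {m : ℕ} {d : Fin (m+1) → ℕ} {a h e q r : ℕ} (h0 : d 0 = a) (ha : 0 < a)
    (he : 0 < e) (hd : ∀ i : Fin m, d i.succ = h * a + (i + 1) * e)
    (hco : Nat.Coprime a e) (haq : a = m * q + r) (hr : 0 < r) :
    Isol d (Finsupp.single 0 ((q + 1) * h + e)) := by
  intro i hi v hv
  have : i = 0 := by
    by_contra hc
    exact hi (by simp [Finsupp.single_apply, Ne.symm hc])
  subst this
  rw [← Finsupp.single_tsub, wt0_single, h0] at hv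
  rw [← Finsupp.single_tsub]
  obtain ⟨D, S, hw, hDS, hSD, hv0, -⟩ := wt0_ga h0 hd v
  rw [hw] at hv
  have hdvd : a ∣ S := by
    apply hco.dvd_of_dvd_mul_right
    rw [← Nat.dvd_add_right (b := v 0 * a + D * h * a), hv]
    · exact Dvd.intro_left _ rfl
    · exact dvd_add (Dvd.intro_left _ rfl) (Dvd.intro_left _ rfl)
  obtain ⟨c, rfl⟩ := hdvd
  have hv2 : v 0 + D * h + c * e = (q + 1) * h + e - 1 := by
    apply Nat.eq_of_mul_eq_mul_right ha
    rw [← hv]; ring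
  rcases Nat.eq_zero_or_pos c with rfl | hc
  · have hD : D = 0 := by omega
    rw [hv0 hD]
    subst hD
    simp at hv2
    rw [hv2]
  · exfalso
    have h1 : m * q < m * D := by
      have : a ≤ a * c := Nat.le_mul_of_pos_right _ hc
      omega
    have h2 : q < D := lt_of_mul_lt_mul_left h1 (Nat.zero_le _)
    have h3 : (q + 1) * h ≤ D * h := Nat.mul_le_mul_right _ h2
    have h4 : e ≤ c * e := Nat.le_mul_of_pos_left _ hc
    omega

lemma isol_two {d : Fin 3 → ℕ} {a h e q : ℕ} (h0 : d 0 = a)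
    (he : 0 < e) (hh : 0 < h) (hd : ∀ i : Fin 2, d i.succ = h * a + (i + 1) * e)
    (hco : Nat.Coprime a e) (haq : a = 2 * q + 1) :
    Isol d (Finsupp.single 2 (q + 1)) := by
  intro i hi v hv
  have : i = 2 := by
    by_contra hc
    exact hi (by simp [Finsupp.single_apply, Ne.symm hc])
  subst this
  have h2 := hd 1
  simp at h2
  rw [← Finsupp.single_tsub, wt0_single, h2] at hv
  rw [← Finsupp.single_tsub]
  obtain ⟨D, S, hw, hDS, hSD, hv0, hv1⟩ := wt0_ga h0 hd v
  rw [hw] at hv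
  simp only [Nat.add_sub_cancel] at hv ⊢
  have hmod : S ≡ 2 * q [MOD a] := by
    apply Nat.ModEq.cancel_right_of_coprime (c := e) hco
    have : (v 0 * a + D * h * a + S * e) ≡ q * (h * a + 2 * e) [MOD a] := by
      rw [hv]
    unfold Nat.ModEq at *
    rw [show v 0 * a + D * h * a + S * e = S * e + a * (v 0 + D * h) by ring,
      show q * (h * a + 2 * e) = 2 * q * e + a * (q * h) by ring,
      Nat.add_mul_mod_self_left, Nat.add_mul_mod_self_left] at this
    exact this
  have hS : S = 2 * q + a * (S / a) := by
    have h1 := Nat.div_add_mod S a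
    have h2 : S % a = 2 * q := by
      rw [hmod, Nat.mod_eq_of_lt (by omega)]
    omega
  generalize S / a = c at hS
  have hqD : q ≤ D := by
    have : 2 * q ≤ 2 * D := by
      have := Nat.zero_le (a * c)
      omega
    omega
  have hv2 : v 0 + D * h + c * e = q * h := by
    apply Nat.eq_of_mul_eq_mul_right (show 0 < a by omega)
    have : v 0 * a + D * h * a + S * e = (v 0 + D * h + c * e) * a + 2 * q * e := by
      rw [hS]; ring
    have : q * (h * a + 2 * e) = q * h * a + 2 * q * e := by ring
    omega
  have h3 : q * h ≤ D * h := Nat.mul_le_mul_right _ hqD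
  have hv00 : v 0 = 0 := by omega
  have hce : c = 0 := by
    have : c * e = 0 := by omega
    rcases Nat.mul_eq_zero.1 this with h | h <;> omega
  have hDq : D = q := Nat.eq_of_mul_eq_mul_right hh (by omega)
  subst hce hDq
  have hv10 : v 1 = 0 := hv1 (by omega) 0 (by simp)
  have hv22 : v 2 = D := by
    have hw' := hw
    rw [wt0, Fin.sum_univ_three, hv00, hv10, h2] at hw'
    simp at hw'
    apply Nat.eq_of_mul_eq_mul_right (show 0 < h * a + 2 * e by omega)
    rw [hw', hS]; ring
  ext t
  fin_cases t <;> simp [hv00, hv10, hv22]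

lemma case_ge4 {k : Type*} [Field k] {m : ℕ} {d : Fin (m+1) → ℕ} {a h e : ℕ} (hm : 3 ≤ m)
    (hpos : ∀ i, 0 < d i) (hmin : MinimallyGenerates d)
    (h0 : d 0 = a) (hh : 0 < h) (he : 0 < e) (ham : m < a)
    (hd : ∀ i : Fin m, d i.succ = h * a + (i + 1) * e)
    (hco : Nat.Coprime a e) : ¬ IsCI k d := by
  classical
  intro hCI
  have hdd : ∀ j (hj : j < m + 1), 0 < j → d ⟨j, hj⟩ = h * a + j * e := by
    intro j hj hj0
    obtain ⟨i, rfl⟩ : ∃ i, j = i + 1 := ⟨j - 1, by omega⟩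
    exact hd ⟨i, by omega⟩
  obtain ⟨q, r, hqr, hr, hrm, hq⟩ : ∃ q r, a = m * q + r ∧ 0 < r ∧ r ≤ m ∧ 0 < q := by
    refine ⟨(a - 1) / m, (a - 1) % m + 1, ?_, by omega, ?_, ?_⟩
    · have := Nat.div_add_mod (a - 1) m
      omega
    · exact Nat.mod_lt _ (by omega)
    · exact Nat.div_pos (by omega) (by omega)
  let x : ℕ → ℕ → (Fin (m+1) →₀ ℕ) := fun j c =>
    if hj : j < m + 1 then Finsupp.single ⟨j, hj⟩ c else 0
  have hx : ∀ j c (hj : j < m + 1), x j c = Finsupp.single ⟨j, hj⟩ c := fun j c hj => by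
    simp only [x]; rw [dif_pos hj]
  have hxa : ∀ j c (t : Fin (m+1)), j < m + 1 → x j c t = if j = (t : ℕ) then c else 0 := by
    intro j c t hj
    rw [hx j c hj, Finsupp.single_apply]
    simp [Fin.ext_iff]
  have hxb : ∀ j c s (hs : s < m + 1), j < m + 1 → x j c ⟨s, hs⟩ = if j = s then c else 0 :=
    fun j c s hs hj => hxa j c ⟨s, hs⟩ hj
  have hxw0 : ∀ c, wt0 d (x 0 c) = c * a := by
    intro c
    rw [hx 0 c (by omega), wt0_single]
    congr 1
  have hxw : ∀ j c, 0 < j → j < m + 1 → wt0 d (x j c) = c * (h * a + j * e) := by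
    intro j c hj hj'
    rw [hx j c hj', wt0_single, hdd j hj' hj]
  let T : Fin (m+1) → (Fin (m+1) →₀ ℕ) := fun j =>
    if (j : ℕ) = 0 then x 0 ((q + 1) * h + e) else if (j : ℕ) = m then x 2 1 + x 2 1
    else x 1 1 + x j 1
  let P : Fin (m+1) → (Fin (m+1) →₀ ℕ) := fun j =>
    if (j : ℕ) = 0 then x m q + x r 1 else if (j : ℕ) = m then
      (if m = 3 then x 1 1 + x 3 1 else x 0 h + x 4 1)
    else x 0 h + x (j + 1) 1
  have hNpos : 0 < (q + 1) * h + e := by omega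
  have A0 : ∀ j : Fin (m+1), T j ⟨0, by omega⟩ ≠ 0 ↔ (j : ℕ) = 0 := by
    intro j
    have hj := j.2
    simp only [T]
    generalize (q + 1) * h + e = N at *
    split_ifs <;> simp (disch := omega) only [Finsupp.add_apply, hxb] <;> split_ifs <;> constructor <;> intro _ <;> first | omega | (simp_all; done)
  have A1 : ∀ j : Fin (m+1), (j : ℕ) ≠ 0 → (T j ⟨1, by omega⟩ = 0 ↔ (j : ℕ) = m) := by
    intro j hj0
    by_cases hjm : (j : ℕ) = m
    · simp only [T]
      rw [if_neg hj0, if_pos hjm, Finsupp.add_apply, hxb 2 _ _ _ (by omega), if_neg (by omega)]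
      exact ⟨fun _ => hjm, fun _ => rfl⟩
    · simp only [T]
      rw [if_neg hj0, if_neg hjm, Finsupp.add_apply, hxb 1 _ _ _ (by omega), if_pos rfl]
      exact ⟨fun h => absurd h (by omega), fun h => absurd h hjm⟩
  have A2 : ∀ j t : Fin (m+1), (j : ℕ) ≠ 0 → (j : ℕ) ≠ m → (T j t ≠ 0 ↔ ((t : ℕ) = 1 ∨ (t : ℕ) = j)) := by
    intro j t hj0 hjm
    have hj := j.2
    simp only [T]
    rw [if_neg hj0, if_neg hjm]
    simp (disch := omega) only [Finsupp.add_apply, hxa]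
    split_ifs <;> constructor <;> intro _ <;> first | omega | (simp_all; done)
  have A3 : ∀ j : Fin (m+1), T j ⟨m, by omega⟩ = 0 := by
    intro j
    have hj := j.2
    simp only [T]
    split_ifs <;> simp (disch := omega) only [Finsupp.add_apply, hxa] <;> split_ifs <;> omega
  have A4 : ∀ (j t : Fin (m+1)), (j : ℕ) = 0 → (t : ℕ) ≠ 0 → T j t = 0 := by
    intro j t hj0 ht
    simp only [T]
    rw [if_pos hj0, hxa _ _ _ (by omega), if_neg (by omega)]
  clear_value x
  refine not_CI (by omega) hCI T P ?_ ?_ ?_ ?_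
  · intro i j hij
    have e0 := A0 i
    have e0' := A0 j
    have e1 := A1 i
    have e1' := A1 j
    have e2 := A2 i i
    have e2' := A2 j i
    rw [hij] at e0 e1 e2
    have hi := i.2
    have hj := j.2
    ext
    by_cases c0 : (i : ℕ) = 0
    · omega
    by_cases cm : (i : ℕ) = m
    · omega
    have e3 := A2 i j
    have e3' := A2 j j
    rw [hij] at e3
    omega
  · intro j
    simp only [T]
    split_ifs with h1 h2
    · rw [hx 0 _ (by omega)]
      exact isol_zero h0 (by omega) he hd hco hqr hr
    · rw [hx 2 _ (by omega)]; exact isol_pair hpos hmin _ _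
    · rw [hx 1 _ (by omega), hx j _ j.2]; exact isol_pair hpos hmin _ _
  · intro j
    have hj := j.2
    simp only [T, P]
    split_ifs with h1 h2 h3
    · rw [hxw0, wt0_add, hxw _ _ (by omega) (by omega), hxw _ _ (by omega) (by omega)]
      have : q * (h * a + m * e) + 1 * (h * a + r * e) = (q + 1) * h * a + (m * q + r) * e := by
        ring
      rw [this, ← hqr]; ring
    · simp (disch := omega) only [wt0_add, hxw, hxw0]; ring
    · simp (disch := omega) only [wt0_add, hxw, hxw0]; ring
    · simp (disch := omega) only [wt0_add, hxw, hxw0]; ring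
  · intro i j hij
    have hi := i.2
    have key : P i ⟨m, by omega⟩ ≠ 0 ∨ (P i ⟨0, by omega⟩ ≠ 0 ∧
        ∃ t : Fin (m+1), (t : ℕ) ≠ 0 ∧ P i t ≠ 0) := by
      simp only [P]
      split_ifs with c1 c2 c3
      · left
        simp (disch := omega) only [Finsupp.add_apply, hxa]
        split_ifs <;> omega
      · left
        simp (disch := omega) only [Finsupp.add_apply, hxa]
        split_ifs <;> omega
      · right
        refine ⟨?_, ⟨4, by omega⟩, by simp, ?_⟩
        · simp (disch := omega) only [Finsupp.add_apply, hxa]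
          split_ifs <;> omega
        · simp (disch := omega) only [Finsupp.add_apply, hxa]
          split_ifs <;> omega
      · right
        refine ⟨?_, ⟨i + 1, by omega⟩, by simp, ?_⟩
        · simp (disch := omega) only [Finsupp.add_apply, hxa]
          split_ifs <;> omega
        · simp (disch := omega) only [Finsupp.add_apply, hxa]
          split_ifs <;> omega
    rw [hij] at key
    rcases key with k1 | ⟨k1, t, ht, k2⟩
    · exact k1 (A3 j)
    · exact k2 (A4 j t ((A0 j).1 k1) ht)

lemma case_3 {k : Type*} [Field k] {d : Fin 3 → ℕ} {a h e : ℕ}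
    (hpos : ∀ i, 0 < d i) (hmin : MinimallyGenerates d)
    (h0 : d 0 = a) (hh : 0 < h) (he : 0 < e) (ham : 2 < a)
    (hd : ∀ i : Fin 2, d i.succ = h * a + (i + 1) * e)
    (hco : Nat.Coprime a e) (hodd : Odd a) : ¬ IsCI k d := by
  classical
  intro hCI
  obtain ⟨q, hq⟩ := hodd
  have hq0 : 0 < q := by omega
  have h1 : d 1 = h * a + e := by simpa using hd 0
  have h2 : d 2 = h * a + 2 * e := by simpa using hd 1
  refine not_CI (by omega) hCI
    ![Finsupp.single 1 1 + Finsupp.single 1 1, Finsupp.single 0 ((q+1)*h+e), Finsupp.single 2 (q+1)]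
    ![Finsupp.single 0 h + Finsupp.single 2 1, Finsupp.single 2 q + Finsupp.single 1 1,
      Finsupp.single 0 (q * h + e) + Finsupp.single 1 1] ?_ ?_ ?_ ?_
  · intro i j hij
    have e0 := DFunLike.congr_fun hij 0
    have e1 := DFunLike.congr_fun hij 1
    have e2 := DFunLike.congr_fun hij 2
    fin_cases i <;> fin_cases j <;> simp at e0 e1 e2 ⊢ <;> omega
  · intro i
    fin_cases i
    · exact isol_pair hpos hmin _ _
    · exact isol_zero h0 (by omega) he hd hco hq (by omega)
    · exact isol_two h0 he hh hd hco hq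
  · intro i
    fin_cases i
    · simp [wt0_add, wt0_single, h0, h1, h2]; ring
    · change wt0 d (Finsupp.single 0 ((q+1)*h+e)) = wt0 d (Finsupp.single 2 q + Finsupp.single 1 1)
      rw [wt0_add, wt0_single, wt0_single, wt0_single, h0, h1, h2]
      calc _ = (q+1)*h*a + a*e := by ring
        _ = (q+1)*h*a + (2*q+1)*e := by rw [← hq]
        _ = _ := by ring
    · change wt0 d (Finsupp.single 2 (q+1)) =
        wt0 d (Finsupp.single 0 (q * h + e) + Finsupp.single 1 1)
      rw [wt0_add, wt0_single, wt0_single, wt0_single, h0, h1, h2]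
      calc _ = (q+1)*h*a + (2*q+1)*e + e := by ring
        _ = (q+1)*h*a + a*e + e:= by rw [← hq]
        _ = _ := by ring
  · intro i j hij
    have e0 := DFunLike.congr_fun hij 0
    have e1 := DFunLike.congr_fun hij 1
    have e2 := DFunLike.congr_fun hij 2
    fin_cases i <;> fin_cases j <;> simp at e0 e1 e2 <;> omega

lemma ci_3 {k : Type*} [Field k] {d : Fin 3 → ℕ} {a h e p : ℕ}
    (h0 : d 0 = a) (hp : 0 < p) (hap : a = 2 * p)
    (hd : ∀ i : Fin 2, d i.succ = h * a + (i + 1) * e)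
    (hco : Nat.Coprime a e) : IsCI k d := by
  classical
  have h1 : d 1 = h * a + e := by simpa using hd 0
  have h2 : d 2 = h * a + 2 * e := by simpa using hd 1
  let f1 : MvPolynomial (Fin 3) k :=
    monomial (Finsupp.single 1 2) 1 - monomial (Finsupp.single 0 h + Finsupp.single 2 1) 1
  let f2 : MvPolynomial (Fin 3) k :=
    monomial (Finsupp.single 2 p) 1 - monomial (Finsupp.single 0 (p * h + e)) 1
  let g : Fin 2 → MvPolynomial (Fin 3) k := ![f1, f2]
  have hf1 : f1 = X 1 ^ 2 - X 0 ^ h * X 2 := by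
    simp only [f1, X_pow_eq_monomial]
    rw [X, monomial_mul, one_mul]
  have hf2 : f2 = X 2 ^ p - X 0 ^ (p * h + e) := by
    simp only [f2, X_pow_eq_monomial]
  have hle : Ideal.span (Set.range g) ≤ toricIdeal k d := by
    rw [Ideal.span_le]
    rintro _ ⟨i, rfl⟩
    fin_cases i
    · apply binom_mem
      simp [wt0_add, wt0_single, h0, h1, h2]; ring
    · apply binom_mem
      rw [wt0_single, wt0_single, h0, h2, hap]; ring
  refine ⟨g, le_antisymm hle ?_⟩
  set J := Ideal.span (Set.range g) with hJ
  have q1 : (Ideal.Quotient.mk J (X 1)) ^ 2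
      = (Ideal.Quotient.mk J (X 0)) ^ h * Ideal.Quotient.mk J (X 2) := by
    rw [← map_pow, ← map_pow, ← map_mul, Ideal.Quotient.eq, ← hf1]
    exact Ideal.subset_span ⟨0, rfl⟩
  have q2 : (Ideal.Quotient.mk J (X 2)) ^ p = (Ideal.Quotient.mk J (X 0)) ^ (p * h + e) := by
    rw [← map_pow, ← map_pow, Ideal.Quotient.eq, ← hf2]
    exact Ideal.subset_span ⟨1, rfl⟩
  have hmono : ∀ u : Fin 3 →₀ ℕ, (monomial u 1 : MvPolynomial (Fin 3) k)
      = X 0 ^ u 0 * X 1 ^ u 1 * X 2 ^ u 2 := by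
    intro u
    rw [monomial_eq, Finsupp.prod_fintype _ _ (by simp), Fin.prod_univ_three]
    simp
  have hred : ∀ u : Fin 3 →₀ ℕ, ∃ v : Fin 3 →₀ ℕ, v 1 < 2 ∧ v 2 < p ∧
      (monomial u 1 - monomial v 1 : MvPolynomial (Fin 3) k) ∈ J := by
    intro u
    let l := u 2 + u 1 / 2
    let v : Fin 3 →₀ ℕ := Finsupp.equivFunOnFinite.symm
      ![u 0 + h * (u 1 / 2) + (p * h + e) * (l / p), u 1 % 2, l % p]
    refine ⟨v, Nat.mod_lt _ (by omega), Nat.mod_lt _ hp, ?_⟩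
    rw [← Ideal.Quotient.eq, hmono, hmono]
    simp only [map_mul, map_pow]
    have v0 : v 0 = u 0 + h * (u 1 / 2) + (p * h + e) * (l / p) := rfl
    have v1 : v 1 = u 1 % 2 := rfl
    have v2 : v 2 = l % p := rfl
    rw [v0, v1, v2]
    generalize Ideal.Quotient.mk J (X 0) = A at *
    generalize Ideal.Quotient.mk J (X 1) = B at *
    generalize Ideal.Quotient.mk J (X 2) = D at *
    calc A ^ u 0 * B ^ u 1 * D ^ u 2
        = A ^ u 0 * ((B ^ 2) ^ (u 1 / 2) * B ^ (u 1 % 2)) * D ^ u 2 := by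
          rw [← pow_mul, ← pow_add, Nat.div_add_mod]
      _ = A ^ u 0 * (A ^ h) ^ (u 1 / 2) * B ^ (u 1 % 2) * D ^ l := by
          rw [q1]; simp only [l]; ring
      _ = A ^ u 0 * (A ^ h) ^ (u 1 / 2) * B ^ (u 1 % 2) * ((D ^ p) ^ (l / p) * D ^ (l % p)) := by
          rw [← pow_mul D, ← pow_add D, Nat.div_add_mod]
      _ = _ := by
          rw [q2, ← pow_mul, ← pow_mul, pow_add, pow_add]; ring
  choose v hv1 hv2 hvJ using hred
  intro f hf
  let r : MvPolynomial (Fin 3) k := ∑ u ∈ f.support, monomial (v u) (coeff u f)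
  have hfr : f - r ∈ J := by
    have : f - r = ∑ u ∈ f.support, C (coeff u f) * (monomial u 1 - monomial (v u) 1) := by
      conv_lhs => rw [f.as_sum]
      simp only [r]
      rw [← Finset.sum_sub_distrib]
      refine Finset.sum_congr rfl fun u _ => ?_
      rw [mul_sub, C_mul_monomial, C_mul_monomial, mul_one]
    rw [this]
    exact Submodule.sum_mem _ fun u _ => Ideal.mul_mem_left _ _ (hvJ u)
  have hrI : r ∈ toricIdeal k d := by
    have := Ideal.sub_mem _ hf (hle hfr)
    simpa using this
  have hrs : ∀ w ∈ r.support, w 1 < 2 ∧ w 2 < p := by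
    intro w hw
    obtain ⟨u, -, hu⟩ := Finset.mem_biUnion.1 (support_sum hw)
    have := support_monomial_subset hu
    rw [Finset.mem_singleton] at this
    subst this
    exact ⟨hv1 u, hv2 u⟩
  have hr0 : r = 0 := by
    by_contra hne
    obtain ⟨w, hw⟩ := Finset.nonempty_iff_ne_empty.2 (mt support_eq_empty.1 hne)
    apply mem_support_iff.1 hw
    apply coeff_zero_of_unique hrI
    intro z hz hzw
    obtain ⟨a1, a2⟩ := hrs w hw
    obtain ⟨b1, b2⟩ := hrs z hz
    simp only [wt0, Fin.sum_univ_three, h0, h1, h2] at hzw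
    have hmod : z 1 + 2 * z 2 ≡ w 1 + 2 * w 2 [MOD a] := by
      apply Nat.ModEq.cancel_right_of_coprime (c := e) hco
      have h3 : (z 1 + 2 * z 2) * e + a * (z 0 + z 1 * h + z 2 * h)
        = (w 1 + 2 * w 2) * e + a * (w 0 + w 1 * h + w 2 * h) := by linarith
      have := congrArg (· % a) h3
      simp only [Nat.add_mul_mod_self_left] at this
      exact this
    have hm2 := Nat.ModEq.eq_of_lt_of_lt hmod (by omega) (by omega)
    have c1 : z 1 = w 1 := by omega
    have c2 : z 2 = w 2 := by omega
    rw [c1, c2] at hzw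
    have c0 : z 0 = w 0 := Nat.eq_of_mul_eq_mul_right (show 0 < a by omega) (by omega)
    ext t
    fin_cases t
    · exact c0
    · exact c1
    · exact c2
  rwa [hr0, sub_zero] at hfr

/-- For a generalized arithmetic sequence `A = {d₁,…,dₙ}` of positive
integers with `n ≥ 3`, `gcd(A) = 1` and `A` minimally generating its numerical
semigroup, the toric ideal `I_A` is a complete intersection iff `n = 3` and `d₁`
is even. -/
theorem stmt0 (k : Type*) [Field k] (n : ℕ) (d : Fin n → ℕ)
    (hn : 3 ≤ n) (hpos : ∀ i, 0 < d i) (hga : IsGenArith d)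
    (hgcd : Finset.univ.gcd d = 1) (hmin : MinimallyGenerates d) :
    IsCI k d ↔ n = 3 ∧ Even (d ⟨0, by omega⟩) := by
  obtain ⟨m, rfl⟩ : ∃ m, n = m + 1 := ⟨n - 1, by omega⟩
  obtain ⟨h, e, hh, he, hd'⟩ := hga
  have hd : ∀ i : Fin m, d i.succ = h * d 0 + (i + 1) * e := fun i => by
    have := hd' i.succ (by simp)
    simpa using this
  have ha := hpos 0
  have hco : Nat.Coprime (d 0) e := by
    have : Nat.gcd (d 0) e ∣ Finset.univ.gcd d := by
      apply Finset.dvd_gcd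
      intro i _
      refine Fin.cases (Nat.gcd_dvd_left _ _) (fun i => ?_) i
      rw [hd]
      exact dvd_add ((Nat.gcd_dvd_left _ _).mul_left _) ((Nat.gcd_dvd_right _ _).mul_left _)
    rw [hgcd] at this
    exact Nat.dvd_one.1 this
  have ham : m < d 0 := by
    by_contra hle
    push Not at hle
    have hne : (⟨d 0, by omega⟩ : Fin (m+1)) ≠ 0 := by
      intro hc
      have := congrArg Fin.val hc
      simp at this
      omega
    apply hmin ⟨d 0, by omega⟩
    refine ⟨Finsupp.single 0 (h + e), by simp [Finsupp.single_apply, hne.symm], ?_⟩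
    have h1 := wt0_single d 0 (h + e)
    rw [wt0] at h1
    rw [h1]
    have h2 := hd' ⟨d 0, by omega⟩ ha
    rw [h2]
    have : d ⟨0, by omega⟩ = d 0 := rfl
    simp only [this]; ring
  have hz : d ⟨0, by omega⟩ = d 0 := rfl
  constructor
  · intro hCI
    by_cases hm : 3 ≤ m
    · exact absurd hCI (case_ge4 hm hpos hmin rfl hh he ham hd hco)
    · have : m = 2 := by omega
      subst this
      refine ⟨rfl, ?_⟩
      by_contra hodd
      exact case_3 hpos hmin rfl hh he ham hd hco (Nat.not_even_iff_odd.1 hodd) hCI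
  · rintro ⟨hm, hev⟩
    have : m = 2 := by omega
    subst this
    obtain ⟨p, hp⟩ := hev
    rw [hz] at hp
    exact ci_3 rfl (p := p) (by omega) (by omega) hd hco
end

section
/- Let A = {d_1, …, d_n} be an increasing arithmetic sequence of positive integers with n ≥ 2, gcd(d_1, …, d_n) = 1, and such that A minimally generates the numerical semigroup ℕd_1 + … + ℕd_n. Then the toric ideal I_A is a complete intersection if and only if n = 2, or n = 3 and d_1 is even. -/
open MvPolynomial

namespace CIaux

def wt {n : ℕ} (d : Fin n → ℕ) (u : Fin n →₀ ℕ) : ℕ := ∑ i, u i * d i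

lemma wt_add {n : ℕ} (d : Fin n → ℕ) (u v : Fin n →₀ ℕ) : wt d (u + v) = wt d u + wt d v := by
  simp [wt, add_mul, Finset.sum_add_distrib]

lemma wt_single {n : ℕ} (d : Fin n → ℕ) (i : Fin n) (c : ℕ) :
    wt d (Finsupp.single i c) = c * d i := by
  unfold wt
  rw [Finset.sum_eq_single i]
  · simp
  · intro b _ hb
    simp [Finsupp.single_apply, hb.symm]
  · simp

lemma exists_sub {n : ℕ} (v : Fin n →₀ ℕ) (i : Fin n) (h : v i ≠ 0) :
    ∃ v', v = v' + Finsupp.single i 1 := by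
  refine ⟨v - Finsupp.single i 1, ?_⟩
  rw [tsub_add_cancel_of_le]
  simpa [Finsupp.single_le_iff] using Nat.one_le_iff_ne_zero.mpr h

lemma phi_monomial (k : Type*) [Field k] {n : ℕ} (d : Fin n → ℕ) (u : Fin n →₀ ℕ) (c : k) :
    MvPolynomial.aeval (fun i : Fin n => (Polynomial.X : Polynomial k) ^ d i) (monomial u c)
      = Polynomial.monomial (wt d u) c := by
  rw [aeval_monomial, Finsupp.prod_fintype _ _ (by simp)]
  simp only [← pow_mul, Finset.prod_pow_eq_pow_sum, Polynomial.algebraMap_eq,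
    Polynomial.C_mul_X_pow_eq_monomial]
  congr 1
  simp [wt, mul_comm]

lemma mem_toric (k : Type*) [Field k] {n : ℕ} (d : Fin n → ℕ) (f : MvPolynomial (Fin n) k) :
    f ∈ toricIdeal k d ↔
      MvPolynomial.aeval (fun i : Fin n => (Polynomial.X : Polynomial k) ^ d i) f = 0 := by
  rfl

lemma coeff_zero_of_unique (k : Type*) [Field k] {n : ℕ} (d : Fin n → ℕ)
    (f : MvPolynomial (Fin n) k) (hf : f ∈ toricIdeal k d) (u : Fin n →₀ ℕ)
    (hu : ∀ v, wt d v = wt d u → v = u) : coeff u f = 0 := by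
  rw [mem_toric] at hf
  have h1 : (MvPolynomial.aeval (fun i : Fin n => (Polynomial.X : Polynomial k) ^ d i) f).coeff
      (wt d u) = coeff u f := by
    clear hf
    induction f using MvPolynomial.induction_on' with
    | monomial v c =>
      rw [phi_monomial, Polynomial.coeff_monomial, coeff_monomial]
      by_cases h : v = u
      · simp [h]
      · rw [if_neg h, if_neg (fun h' => h (hu v h'))]
    | add p q hp hq => simp [hp, hq]
  rw [← h1, hf, Polynomial.coeff_zero]

def Iso {n : ℕ} (d : Fin n → ℕ) (u : Fin n →₀ ℕ) : Prop :=
  ∀ v i, u i ≠ 0 → v i ≠ 0 → wt d v = wt d u → v = u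

lemma coeff_mul_iso (k : Type*) [Field k] {n : ℕ} (d : Fin n → ℕ)
    (u : Fin n →₀ ℕ) (hu : Iso d u) (g : MvPolynomial (Fin n) k) (hg : g ∈ toricIdeal k d)
    (a : MvPolynomial (Fin n) k) : coeff u (a * g) = constantCoeff a * coeff u g := by
  induction a using MvPolynomial.induction_on with
  | C a => simp [coeff_C_mul]
  | add p q hp hq => simp [add_mul, hp, hq]
  | mul_X p j _ =>
    have hpg : p * g ∈ toricIdeal k d := Ideal.mul_mem_left _ _ hg
    rw [show p * X j * g = (p * g) * X j by ring, coeff_mul_X']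
    simp only [map_mul, constantCoeff_X, mul_zero, zero_mul]
    split_ifs with h
    · rw [Finsupp.mem_support_iff] at h
      obtain ⟨u', rfl⟩ := exists_sub u j h
      rw [add_tsub_cancel_right]
      apply coeff_zero_of_unique k d _ hpg
      intro v hv
      have := hu (v + Finsupp.single j 1) j h (by simp) (by rw [wt_add, wt_add, hv])
      exact add_right_cancel this
    · rfl

def W {n : ℕ} (d : Fin n → ℕ) (w : ℕ) : Prop :=
  ∃ u v, Iso d u ∧ v ≠ u ∧ wt d u = w ∧ wt d v = w

lemma not_CI (k : Type*) [Field k] {n : ℕ} (d : Fin n → ℕ) (hn : 0 < n)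
    (w : Fin n → ℕ) (hw : Function.Injective w) (hW : ∀ s, W d (w s)) : ¬ IsCI k d := by
  rintro ⟨g, hg⟩
  choose u v hu hv hwu hwv using hW
  have hgm : ∀ i, g i ∈ toricIdeal k d := fun i => hg ▸ Ideal.subset_span ⟨i, rfl⟩
  let G : Fin (n-1) → (Fin n → k) := fun i s => coeff (u s) (g i)
  have hspan : ⊤ ≤ Submodule.span k (Set.range G) := by
    rw [← (Pi.basisFun k (Fin n)).span_eq, Submodule.span_le]
    rintro _ ⟨r, rfl⟩
    have hb : monomial (u r) (1:k) - monomial (v r) 1 ∈ toricIdeal k d := by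
      rw [mem_toric, map_sub, phi_monomial, phi_monomial, hwu, hwv, sub_self]
    rw [← hg, Ideal.mem_span_range_iff_exists_fun] at hb
    obtain ⟨c, hc⟩ := hb
    have : (Pi.basisFun k (Fin n)) r = ∑ i, constantCoeff (c i) • G i := by
      ext s
      have h2 := congrArg (coeff (u s)) hc
      rw [coeff_sum] at h2
      simp only [coeff_mul_iso k d (u s) (hu s) _ (hgm _)] at h2
      simp only [Finset.sum_apply, Pi.smul_apply, smul_eq_mul, G]
      rw [h2, coeff_sub, coeff_monomial, coeff_monomial]
      by_cases hrs : r = s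
      · subst hrs
        simp [hv]
      · have h3 : u r ≠ u s := fun h => hrs (hw (by rw [← hwu r, ← hwu s, h]))
        have h4 : v r ≠ u s := fun h => hrs (hw (by rw [← hwv r, ← hwu s, h]))
        simp [h3, h4, Pi.single_apply, Ne.symm hrs]
    rw [this]
    exact Submodule.sum_mem _ fun i _ => Submodule.smul_mem _ _ (Submodule.subset_span ⟨i, rfl⟩)
  have h5 := finrank_range_le_card (R := k) G
  have h6 : Submodule.span k (Set.range G) = ⊤ := top_le_iff.mp hspan
  rw [Set.finrank, h6, finrank_top] at h5
  simp at h5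
  omega

lemma min1 {n : ℕ} (d : Fin n → ℕ) (hpos : ∀ i, 0 < d i) (hmin : MinimallyGenerates d)
    (v : Fin n →₀ ℕ) (m : Fin n) (h : wt d v = d m) : v = Finsupp.single m 1 := by
  by_cases hm : v m = 0
  · exact absurd ⟨v, hm, h.symm⟩ (hmin m)
  · obtain ⟨v', rfl⟩ := exists_sub v m hm
    rw [wt_add, wt_single] at h
    have h0 : wt d v' = 0 := by omega
    have : v' = 0 := by
      ext i
      unfold wt at h0
      rw [Finset.sum_eq_zero_iff] at h0
      have := h0 i (Finset.mem_univ i)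
      have := hpos i
      rcases Nat.mul_eq_zero.mp (h0 i (Finset.mem_univ i)) with h | h
      · simpa using h
      · omega
    simp [this]

lemma quadW {n : ℕ} (d : Fin n → ℕ) (hpos : ∀ i, 0 < d i) (hmin : MinimallyGenerates d)
    (i j i' j' : Fin n) (h : d i' + d j' = d i + d j) (h1 : i' ≠ i) (h2 : i' ≠ j) :
    W d (d i + d j) := by
  refine ⟨Finsupp.single i 1 + Finsupp.single j 1, Finsupp.single i' 1 + Finsupp.single j' 1,
    ?_, ?_, ?_, ?_⟩
  · intro v l hul hvl hw
    simp only [wt_add, wt_single, one_mul] at hw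
    obtain ⟨v', rfl⟩ := exists_sub v l hvl
    simp only [wt_add, wt_single, one_mul] at hw
    by_cases hli : l = i
    · subst hli
      rw [min1 d hpos hmin v' j (by omega), add_comm]
    · by_cases hlj : l = j
      · subst hlj
        rw [min1 d hpos hmin v' i (by omega)]
      · simp [Finsupp.single_apply, Ne.symm hli, Ne.symm hlj] at hul
  · intro he
    have := DFunLike.congr_fun he i'
    simp [Finsupp.single_apply, h1.symm, h2.symm] at this
  · simp [wt_add, wt_single]
  · simp [wt_add, wt_single, h]

lemma pureW {n : ℕ} (d : Fin n → ℕ) (hpos : ∀ i, 0 < d i) (hmin : MinimallyGenerates d)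
    (i j : Fin n) (hij : j ≠ i) :
    ∃ c, 2 ≤ c ∧ W d (c * d i) ∧ ∀ c' v, v ≠ Finsupp.single i c' → wt d v = c' * d i → c ≤ c' := by
  classical
  have hex : ∃ c, ∃ v, v ≠ Finsupp.single i c ∧ wt d v = c * d i := by
    refine ⟨d j, Finsupp.single j (d i), ?_, ?_⟩
    · intro he
      have := DFunLike.congr_fun he j
      have h := hpos i
      simp [hij.symm, Finsupp.single_apply] at this
      omega
    · rw [wt_single, mul_comm]
  obtain ⟨v, hv, hvw⟩ := Nat.find_spec hex
  have hle : ∀ c' v, v ≠ Finsupp.single i c' → wt d v = c' * d i → Nat.find hex ≤ c' :=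
    fun c' v h1 h2 => Nat.find_min' hex ⟨v, h1, h2⟩
  set c := Nat.find hex
  refine ⟨c, ?_, ⟨Finsupp.single i c, v, ?_, hv, wt_single .., hvw⟩, hle⟩
  · by_contra hc
    have : c = 0 ∨ c = 1 := by omega
    rcases this with h | h
    · rw [h] at hv hvw
      apply hv
      have h7 := min1 d hpos hmin (v + Finsupp.single i 1) i (by rw [wt_add, wt_single]; omega)
      simpa using h7
    · rw [h] at hv hvw
      exact hv (min1 d hpos hmin v i (by omega))
  · intro v' l hul hvl hw
    have hl : l = i := by
      by_contra h
      simp [Finsupp.single_apply, Ne.symm h] at hul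
    subst hl
    obtain ⟨v'', rfl⟩ := exists_sub v' l hvl
    simp at hul
    by_contra hne
    have : c ≤ c - 1 := by
      apply hle (c-1) v''
      · rintro rfl
        apply hne
        rw [← Finsupp.single_add]
        congr 1
        omega
      · simp only [wt_add, wt_single, one_mul] at hw
        rw [Nat.sub_mul]
        omega
    omega

lemma toric_le (k : Type*) [Field k] {n : ℕ} (d : Fin n → ℕ) (J : Ideal (MvPolynomial (Fin n) k))
    (hJ : ∀ u v, wt d u = wt d v → monomial u (1:k) - monomial v 1 ∈ J) : toricIdeal k d ≤ J := by
  let r : ℕ → (Fin n →₀ ℕ) := Function.invFun (wt d)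
  have hr : ∀ u, wt d (r (wt d u)) = wt d u := fun u => Function.invFun_eq ⟨u, rfl⟩
  let R : Polynomial k → MvPolynomial (Fin n) k := fun p => p.sum fun w c => monomial (r w) c
  have key : ∀ f, f - R (MvPolynomial.aeval
      (fun i : Fin n => (Polynomial.X : Polynomial k) ^ d i) f) ∈ J := by
    intro f
    induction f using MvPolynomial.induction_on' with
    | monomial u c =>
      rw [phi_monomial]
      simp only [R]
      rw [Polynomial.sum_monomial_index _ _ (by simp)]
      have := J.mul_mem_left (C c) (hJ u (r (wt d u)) (hr u).symm)
      rwa [mul_sub, C_mul_monomial, C_mul_monomial, mul_one] at this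
    | add p q hp hq =>
      have h := J.add_mem hp hq
      have hR : ∀ a b, R (a + b) = R a + R b := fun a b =>
        Polynomial.sum_add_index a b _ (by simp) (by simp)
      rw [map_add, hR]
      convert h using 1
      ring
  intro f hf
  have := key f
  rw [(mem_toric k d f).mp hf] at this
  simpa [R] using this

lemma two_aux {R : Type*} [CommRing R] (Y Z : R) (p q : ℕ) (hq : 0 < q) (hp : 0 < p)
    (h : Y ^ p = Z ^ q) (hc : Nat.Coprime p q) (i j i' j' : ℕ) (hle : i' ≤ i)
    (he : i * q + j * p = i' * q + j' * p) : Y ^ i * Z ^ j = Y ^ i' * Z ^ j' := by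
  obtain ⟨t, rfl⟩ := Nat.exists_eq_add_of_le hle
  have h1 : t * q + j * p = j' * p := by nlinarith
  have h2 : j ≤ j' := by
    by_contra hlt
    have := Nat.mul_lt_mul_of_pos_right (not_le.mp hlt) hp
    omega
  obtain ⟨s, rfl⟩ := Nat.exists_eq_add_of_le h2
  have h3 : t * q = s * p := by nlinarith
  obtain ⟨m, rfl⟩ : p ∣ t := hc.dvd_of_dvd_mul_right ⟨s, by rw [h3, mul_comm]⟩
  have h4 : s = q * m := by
    apply Nat.eq_of_mul_eq_mul_right hp
    rw [← h3]; ring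
  subst h4
  rw [pow_add, pow_add, pow_mul, h, ← pow_mul]
  ring

lemma two {R : Type*} [CommRing R] (Y Z : R) (p q : ℕ) (hq : 0 < q) (hp : 0 < p)
    (h : Y ^ p = Z ^ q) (hc : Nat.Coprime p q) (i j i' j' : ℕ)
    (he : i * q + j * p = i' * q + j' * p) : Y ^ i * Z ^ j = Y ^ i' * Z ^ j' := by
  rcases le_total i' i with hle | hle
  · exact two_aux Y Z p q hq hp h hc i j i' j' hle he
  · exact (two_aux Y Z p q hq hp h hc i' j' i j hle he.symm).symm

lemma monomial_eq_prod (k : Type*) [Field k] {n : ℕ} (u : Fin n →₀ ℕ) :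
    monomial u (1:k) = ∏ i, (X i : MvPolynomial (Fin n) k) ^ u i := by
  rw [MvPolynomial.monomial_eq, Finsupp.prod_fintype _ _ (by simp)]
  simp

lemma three {R : Type*} [CommRing R] (Y M Z : R) (p q : ℕ) (hq : 0 < q) (hp : 0 < p)
    (h : Y ^ p = Z ^ q) (hM : M ^ 2 = Y * Z) (hc : Nat.Coprime p q) (hodd : (p + q) % 2 = 1)
    (i m j i' m' j' : ℕ)
    (he : i * (2 * q) + m * (p + q) + j * (2 * p) = i' * (2 * q) + m' * (p + q) + j' * (2 * p)) :
    Y ^ i * M ^ m * Z ^ j = Y ^ i' * M ^ m' * Z ^ j' := by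
  have hmm : m % 2 = m' % 2 := by
    have := congrArg (· % 2) he
    simpa [Nat.add_mod, Nat.mul_mod, ← Nat.add_mod p q, hodd] using this
  have hs := Nat.div_add_mod m 2
  have hs' := Nat.div_add_mod m' 2
  rw [← hmm] at hs'
  set s := m / 2
  set s' := m' / 2
  set ε := m % 2
  rw [← hs, ← hs'] at he ⊢
  have h1 := two Y Z p q hq hp h hc (i + s) (j + s) (i' + s') (j' + s') (by nlinarith)
  calc Y ^ i * M ^ (2 * s + ε) * Z ^ j = M ^ ε * (Y ^ (i + s) * Z ^ (j + s)) := by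
        rw [pow_add M, pow_mul, hM, mul_pow]; ring
    _ = M ^ ε * (Y ^ (i' + s') * Z ^ (j' + s')) := by rw [h1]
    _ = _ := by rw [pow_add M, pow_mul, hM, mul_pow]; ring

lemma ci2 (k : Type*) [Field k] (d : Fin 2 → ℕ) (hpos : ∀ i, 0 < d i)
    (hc : Nat.Coprime (d 1) (d 0)) : IsCI k d := by
  refine ⟨fun _ => X 0 ^ d 1 - X 1 ^ d 0, le_antisymm ?_ ?_⟩
  · rw [Ideal.span_le]
    rintro _ ⟨i, rfl⟩
    rw [SetLike.mem_coe, mem_toric]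
    simp [← pow_mul, mul_comm]
  · apply toric_le
    intro u v huv
    set J := Ideal.span (Set.range fun _ : Fin (2-1) =>
      ((X 0 ^ d 1 - X 1 ^ d 0 : MvPolynomial (Fin 2) k)))
    rw [← Ideal.Quotient.mk_eq_mk_iff_sub_mem, monomial_eq_prod, monomial_eq_prod]
    have h : (Ideal.Quotient.mk J (X 0)) ^ d 1 = (Ideal.Quotient.mk J (X 1)) ^ d 0 := by
      rw [← map_pow, ← map_pow, Ideal.Quotient.mk_eq_mk_iff_sub_mem]
      exact Ideal.subset_span ⟨0, rfl⟩
    simp only [Fin.prod_univ_two, map_mul, map_pow]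
    apply two _ _ _ _ (hpos 0) (hpos 1) h hc
    simpa [wt, Fin.sum_univ_two] using huv

lemma ci3 (k : Type*) [Field k] (d : Fin 3 → ℕ) (p q : ℕ) (hq : 0 < q) (hp : 0 < p)
    (h0 : d 0 = 2 * q) (h1 : d 1 = p + q) (h2 : d 2 = 2 * p)
    (hc : Nat.Coprime p q) (hodd : (p + q) % 2 = 1) : IsCI k d := by
  refine ⟨![X 0 ^ p - X 2 ^ q, X 1 ^ 2 - X 0 * X 2], le_antisymm ?_ ?_⟩
  · rw [Ideal.span_le]
    rintro _ ⟨i, rfl⟩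
    rw [SetLike.mem_coe, mem_toric]
    fin_cases i
    · simp [← pow_mul, h0, h2]
      ring
    · simp [← pow_mul, h0, h2, h1]
      ring
  · apply toric_le
    intro u v huv
    set J := Ideal.span (Set.range (![X 0 ^ p - X 2 ^ q, X 1 ^ 2 - X 0 * X 2] :
      Fin (3-1) → MvPolynomial (Fin 3) k))
    rw [← Ideal.Quotient.mk_eq_mk_iff_sub_mem, monomial_eq_prod, monomial_eq_prod]
    have h : (Ideal.Quotient.mk J (X 0)) ^ p = (Ideal.Quotient.mk J (X 2)) ^ q := by
      rw [← map_pow, ← map_pow, Ideal.Quotient.mk_eq_mk_iff_sub_mem]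
      exact Ideal.subset_span ⟨0, rfl⟩
    have h' : (Ideal.Quotient.mk J (X 1)) ^ 2 =
        (Ideal.Quotient.mk J (X 0)) * (Ideal.Quotient.mk J (X 2)) := by
      rw [← map_pow, ← map_mul, Ideal.Quotient.mk_eq_mk_iff_sub_mem]
      exact Ideal.subset_span ⟨1, rfl⟩
    simp only [Fin.prod_univ_three, map_mul, map_pow]
    apply three _ _ _ _ _ hq hp h h' hc hodd
    simpa [wt, Fin.sum_univ_three, h0, h1, h2] using huv

lemma nci5 (k : Type*) [Field k] {n : ℕ} (d : Fin n → ℕ) (hn : 5 ≤ n)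
    (hpos : ∀ i, 0 < d i) (hmin : MinimallyGenerates d) (a e : ℕ) (he : 0 < e)
    (hd : ∀ i : Fin n, d i = a + i * e) : ¬ IsCI k d := by
  apply not_CI k d (by omega) (fun s => 2 * a + (s + 2) * e)
  · intro s t h
    simp only at h
    have : ((s:ℕ) + 2) * e = (t + 2) * e := by omega
    have := Nat.eq_of_mul_eq_mul_right he this
    ext
    omega
  · intro s
    have hs := s.2
    obtain ⟨i, hi⟩ : ∃ i, i = ((s:ℕ) + 2) / 2 := ⟨_, rfl⟩
    obtain ⟨j, hj⟩ : ∃ j, j = ((s:ℕ) + 3) / 2 := ⟨_, rfl⟩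
    have := quadW d hpos hmin ⟨i, by omega⟩ ⟨j, by omega⟩ ⟨i - 1, by omega⟩ ⟨j + 1, by omega⟩
      (by
        simp only [hd]
        obtain ⟨i, rfl⟩ : ∃ i', i = i' + 1 := ⟨i - 1, by omega⟩
        simp only [Nat.add_sub_cancel]
        ring) (by simp; omega) (by simp; omega)
    convert this using 1
    simp only [hd]
    rw [show (s:ℕ) + 2 = i + j by omega]
    ring

lemma nci4 (k : Type*) [Field k] (d : Fin 4 → ℕ)
    (hpos : ∀ i, 0 < d i) (hmin : MinimallyGenerates d) (a e : ℕ) (he : 0 < e)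
    (hd : ∀ i : Fin 4, d i = a + i * e) : ¬ IsCI k d := by
  obtain ⟨c, hc, hW, -⟩ := pureW d hpos hmin 3 0 (by decide)
  have d0 : d 0 = a := by simp [hd]
  have d1 : d 1 = a + e := by simp [hd]
  have d2 : d 2 = a + 2 * e := by simp [hd]
  have d3 : d 3 = a + 3 * e := by simp [hd]
  have w1 := quadW d hpos hmin 1 1 0 2 (by omega) (by decide) (by decide)
  have w2 := quadW d hpos hmin 1 2 0 3 (by omega) (by decide) (by decide)
  have w3 := quadW d hpos hmin 2 2 1 3 (by omega) (by decide) (by decide)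
  have hlt : 2 * d 3 ≤ c * d 3 := Nat.mul_le_mul_right _ hc
  generalize c * d 3 = w4 at *
  apply not_CI k d (by omega) ![d 1 + d 1, d 1 + d 2, d 2 + d 2, w4]
  · intro s t h
    fin_cases s <;> fin_cases t <;> simp at h ⊢ <;> omega
  · intro s
    fin_cases s <;> simpa

lemma nci3 (k : Type*) [Field k] (d : Fin 3 → ℕ)
    (hpos : ∀ i, 0 < d i) (hmin : MinimallyGenerates d) (a e : ℕ) (he : 0 < e)
    (hd : ∀ i : Fin 3, d i = a + i * e) (hodd : a % 2 = 1) (ha : 3 ≤ a)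
    (hcop : Nat.Coprime a e) : ¬ IsCI k d := by
  obtain ⟨c, hc, hW, hle⟩ := pureW d hpos hmin 2 0 (by decide)
  obtain ⟨b, hb, hW', -⟩ := pureW d hpos hmin 0 2 (by decide)
  have d0 : d 0 = a := by simp [hd]
  have d1 : d 1 = a + e := by simp [hd]
  have d2 : d 2 = a + 2 * e := by simp [hd]
  have w1 := quadW d hpos hmin 1 1 0 2 (by omega) (by decide) (by decide)
  have hlt : 2 * d 2 ≤ c * d 2 := Nat.mul_le_mul_right _ hc
  have hne : b * d 0 ≠ d 1 + d 1 := by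
    intro h
    have h1 : wt d (Finsupp.single 0 (b - 1)) = d 2 := by
      rw [wt_single, Nat.sub_mul]
      omega
    have := DFunLike.congr_fun (min1 d hpos hmin _ _ h1) 0
    simp at this
    omega
  have hne2 : b * d 0 ≠ c * d 2 := by
    intro h
    obtain ⟨q, hq⟩ : ∃ q, a = 2 * q + 1 := ⟨a / 2, by omega⟩
    have hc1 : c ≤ q + 1 := by
      apply hle (q + 1) (Finsupp.single 0 (q + e) + Finsupp.single 1 1)
      · intro h
        have := DFunLike.congr_fun h 1
        simp [Finsupp.single_apply] at this
      · rw [wt_add, wt_single, wt_single, d0, d1, d2, hq]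
        ring
    have h2 : a ∣ c * (a + 2 * e) := ⟨b, by rw [← d2, ← h, d0, mul_comm]⟩
    have h3 : Nat.Coprime a (a + 2 * e) := by
      rw [Nat.coprime_self_add_right]
      exact Nat.Coprime.mul_right (Nat.coprime_two_right.mpr (Nat.odd_iff.mpr hodd)) hcop
    have := Nat.le_of_dvd (by omega) (h3.dvd_of_dvd_mul_right h2)
    omega
  generalize c * d 2 = w4 at *
  generalize b * d 0 = w5 at *
  apply not_CI k d (by omega) ![d 1 + d 1, w4, w5]
  · intro s t h
    fin_cases s <;> fin_cases t <;> simp at h ⊢ <;> omega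
  · intro s
    fin_cases s <;> simpa

end CIaux

open CIaux

/-- For an increasing arithmetic sequence `A = {d₁,…,dₙ}` of positive
integers with `n ≥ 2`, `gcd(A) = 1` and `A` minimally generating its numerical
semigroup, the toric ideal `I_A` is a complete intersection iff `n = 2`, or
`n = 3` and `d₁` is even. -/
theorem stmt1 (k : Type*) [Field k] (n : ℕ) (d : Fin n → ℕ)
    (hn : 2 ≤ n) (hpos : ∀ i, 0 < d i) (ha : IsArithFn d)
    (hgcd : Finset.univ.gcd d = 1) (hmin : MinimallyGenerates d) :
    IsCI k d ↔ n = 2 ∨ (n = 3 ∧ Even (d ⟨0, by omega⟩)) := by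

  have : NeZero n := ⟨by omega⟩
  obtain ⟨e, he, hd'⟩ := ha
  obtain ⟨a, haa⟩ : ∃ a, a = d ⟨0, by omega⟩ := ⟨_, rfl⟩
  have hd : ∀ i : Fin n, d i = a + i * e := by
    intro i
    rcases Nat.eq_zero_or_pos (i : ℕ) with h | h
    · have : i = ⟨0, by omega⟩ := Fin.ext h
      rw [this, haa]; simp
    · rw [hd' i h, haa]
  have hcop : Nat.Coprime a e := by
    rw [Nat.coprime_iff_gcd_eq_one, ← Nat.dvd_one, ← hgcd]
    apply Finset.dvd_gcd
    intro i _
    rw [hd]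
    exact dvd_add (Nat.gcd_dvd_left _ _) (Dvd.dvd.mul_left (Nat.gcd_dvd_right _ _) _)
  have hapos : 0 < a := haa ▸ hpos _
  have han : n ≤ a := by
    by_contra hlt
    have h1 := min1 d hpos hmin (Finsupp.single ⟨0, by omega⟩ (1 + e)) ⟨a, by omega⟩ (by
      rw [wt_single, ← haa, hd]
      simp
      ring)
    have := DFunLike.congr_fun h1 ⟨0, by omega⟩
    simp [Finsupp.single_apply, hapos.ne'] at this
  rw [← haa]
  clear haa hd'
  constructor
  · intro hCI
    by_contra hcon
    have h3 : n = 3 ∨ n = 4 ∨ 5 ≤ n := by omega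
    rcases h3 with rfl | rfl | h5
    · have : a % 2 = 1 := by
        by_contra h
        exact hcon (Or.inr ⟨rfl, Nat.even_iff.mpr (by omega)⟩)
      exact nci3 k d hpos hmin a e he hd this han hcop hCI
    · exact nci4 k d hpos hmin a e he hd hCI
    · exact nci5 k d h5 hpos hmin a e he hd hCI
  · rintro (rfl | ⟨rfl, hev⟩)
    · apply ci2 k d hpos
      simp [hd]
      exact hcop.symm
    · obtain ⟨q, rfl⟩ := hev
      have hq : Nat.Coprime q e := Nat.Coprime.coprime_dvd_left ⟨2, by ring⟩ hcop
      have h2 : Nat.Coprime 2 e := Nat.Coprime.coprime_dvd_left ⟨q, by ring⟩ hcop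
      have hodd := Nat.odd_iff.mp (Nat.coprime_two_left.mp h2)
      apply ci3 k d (q + e) q (by omega) (by omega)
      · simp [hd]; ring
      · simp [hd]; ring
      · simp [hd]; ring
      · simpa using hq.symm
      · omega
end

section
/- Let A = {d_1, …, d_n} be a set of positive integers with n ≥ 4 such that {d_1, …, d_{n−1}} is a generalized arithmetic sequence, gcd(d_1, …, d_n) = 1, and A minimally generates the numerical semigroup ℕd_1 + … + ℕd_n. Then the toric ideal I_A is a complete intersection if and only if n = 4 and one of the following holds: (1) d_1/gcd(d_1, d_2) is even and gcd(d_1, d_2)·d_4 belongs to the semigroup ℕd_1 + ℕd_2 + ℕd_3; or (2) d_1 and d_4 are both even and the toric ideal I_C of the three-element set C = {d_1, d_3, d_4} is a complete intersection (i.e., I_C can be generated by 2 elements). -/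
open MvPolynomial

namespace CIA

/-- degree -/
def dg {n : ℕ} (d u : Fin n → ℕ) : ℕ := ∑ i, u i * d i

/-- monomial -/
noncomputable def mo (k : Type*) [Field k] {n : ℕ} (u : Fin n → ℕ) : MvPolynomial (Fin n) k :=
  ∏ i, X i ^ u i

lemma mo_eq (k : Type*) [Field k] {n : ℕ} (u : Fin n →₀ ℕ) :
    monomial u (1 : k) = mo k (u : Fin n → ℕ) := by
  rw [mo, MvPolynomial.monomial_eq, Finsupp.prod_fintype]
  · simp
  · simp

lemma mo_eq' (k : Type*) [Field k] {n : ℕ} (u : Fin n → ℕ) :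
    mo k u = monomial (Finsupp.equivFunOnFinite.symm u) (1 : k) := by
  rw [mo_eq]; rfl

lemma mo_add (k : Type*) [Field k] {n : ℕ} (u w : Fin n → ℕ) :
    mo k (u + w) = mo k u * mo k w := by
  simp [mo, pow_add, Finset.prod_mul_distrib]

lemma dg_add {n : ℕ} (d u w : Fin n → ℕ) : dg d (u + w) = dg d u + dg d w := by
  simp [dg, add_mul, Finset.sum_add_distrib]

lemma aeval_mo (k : Type*) [Field k] {n : ℕ} (d u : Fin n → ℕ) :
    aeval (fun i : Fin n => (Polynomial.X : Polynomial k) ^ d i) (mo k u)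
      = Polynomial.X ^ dg d u := by
  simp only [mo, map_prod, map_pow, aeval_X, dg, ← pow_mul, Finset.prod_pow_eq_pow_sum]
  congr 1
  exact Finset.sum_congr rfl (fun i _ => mul_comm _ _)

lemma mem_toric (k : Type*) [Field k] {n : ℕ} (d : Fin n → ℕ) (f : MvPolynomial (Fin n) k) :
    f ∈ toricIdeal k d ↔
      aeval (fun i : Fin n => (Polynomial.X : Polynomial k) ^ d i) f = 0 := by
  rfl

lemma binom_mem (k : Type*) [Field k] {n : ℕ} (d u w : Fin n → ℕ) (h : dg d u = dg d w) :
    mo k u - mo k w ∈ toricIdeal k d := by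
  rw [mem_toric, map_sub, aeval_mo, aeval_mo, h, sub_self]

/-- functionals factoring through the degree vanish on the toric ideal -/
lemma factor (k : Type*) [Field k] {n : ℕ} (d : Fin n → ℕ) {V : Type*} [AddCommGroup V]
    [Module k V] (L : MvPolynomial (Fin n) k →ₗ[k] V)
    (hL : ∀ u w, dg d u = dg d w → L (mo k u) = L (mo k w))
    (f : MvPolynomial (Fin n) k) (hf : f ∈ toricIdeal k d) : L f = 0 := by
  classical
  let s : ℕ → V := fun b => if h : ∃ u, dg d u = b then L (mo k h.choose) else 0
  let σ : Polynomial k →ₗ[k] V := (Polynomial.basisMonomials k).constr k s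
  have h1 : L = σ ∘ₗ (aeval (fun i : Fin n => (Polynomial.X : Polynomial k) ^ d i)).toLinearMap := by
    apply (MvPolynomial.basisMonomials (Fin n) k).ext
    intro u
    simp only [MvPolynomial.coe_basisMonomials]
    simp only [LinearMap.comp_apply, AlgHom.toLinearMap_apply]
    rw [mo_eq, aeval_mo]
    have : (Polynomial.X : Polynomial k) ^ dg d u = Polynomial.basisMonomials k (dg d u) := by
      simp [Polynomial.X_pow_eq_monomial]
    rw [this, Module.Basis.constr_basis]
    have hex : ∃ w, dg d w = dg d u := ⟨_, rfl⟩
    simp only [s, dif_pos hex]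
    exact hL _ _ hex.choose_spec.symm
  rw [h1, LinearMap.comp_apply, AlgHom.toLinearMap_apply, (mem_toric k d f).1 hf, map_zero]

lemma toric_le (k : Type*) [Field k] {n : ℕ} (d : Fin n → ℕ) (J : Ideal (MvPolynomial (Fin n) k))
    (hJ : ∀ u w, dg d u = dg d w → mo k u - mo k w ∈ J) : toricIdeal k d ≤ J := by
  intro f hf
  have := factor k d (Ideal.Quotient.mkₐ k J).toLinearMap (fun u w h => by
    simp only [AlgHom.toLinearMap_apply, Ideal.Quotient.mkₐ_eq_mk]
    exact Ideal.Quotient.eq.2 (hJ u w h)) f hf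
  simpa [Ideal.Quotient.eq_zero_iff_mem] using this

/-- closedness under sharing a variable -/
def Closed {n : ℕ} (d : Fin n → ℕ) (W : Set (Fin n → ℕ)) : Prop :=
  ∀ u ∈ W, ∀ w, dg d u = dg d w → (∃ j, 0 < u j ∧ 0 < w j) → w ∈ W

open Classical in
/-- indicator functional -/
noncomputable def ind (k : Type*) [Field k] {n : ℕ} (W : Set (Fin n → ℕ)) :
    MvPolynomial (Fin n) k →ₗ[k] k :=
  (MvPolynomial.basisMonomials (Fin n) k).constr k
    (fun u => if (u : Fin n → ℕ) ∈ W then (1 : k) else 0)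

open Classical in
lemma ind_mo (k : Type*) [Field k] {n : ℕ} (W : Set (Fin n → ℕ)) (u : Fin n → ℕ) :
    ind k W (mo k u) = if u ∈ W then (1 : k) else 0 := by
  have h : mo k u = MvPolynomial.basisMonomials (Fin n) k (Finsupp.equivFunOnFinite.symm u) := by
    rw [mo_eq', MvPolynomial.coe_basisMonomials]
  rw [h, ind, Module.Basis.constr_basis]
  rfl

lemma ind_X (k : Type*) [Field k] {n : ℕ} (d : Fin n → ℕ) (W : Set (Fin n → ℕ))
    (hW : Closed d W) (i : Fin n) (f : MvPolynomial (Fin n) k) (hf : f ∈ toricIdeal k d) :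
    ind k W (X i * f) = 0 := by
  classical
  have hX : (X i : MvPolynomial (Fin n) k) = mo k (Pi.single i 1) := by
    rw [mo, Finset.prod_eq_single i]
    · simp
    · intro b _ hb; simp [hb]
    · simp
  refine factor k d ((ind k W) ∘ₗ (LinearMap.mulLeft k (X i))) ?_ f hf
  intro u w h
  simp only [LinearMap.comp_apply, LinearMap.mulLeft_apply, hX, ← mo_add, ind_mo]
  have hd : dg d (Pi.single i 1 + u) = dg d (Pi.single i 1 + w) := by
    rw [dg_add, dg_add, h]
  have hs : ∃ j, 0 < ((Pi.single i 1 + u : Fin n → ℕ)) j ∧ 0 < ((Pi.single i 1 + w : Fin n → ℕ)) j := ⟨i, by simp⟩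
  have : (Pi.single i 1 + u) ∈ W ↔ (Pi.single i 1 + w) ∈ W :=
    ⟨fun h' => hW _ h' _ hd hs, fun h' => hW _ h' _ hd.symm (by obtain ⟨j, a, b⟩ := hs; exact ⟨j, b, a⟩)⟩
  simp only [this]

lemma ind_mul (k : Type*) [Field k] {n : ℕ} (d : Fin n → ℕ) (W : Set (Fin n → ℕ))
    (hW : Closed d W) (p f : MvPolynomial (Fin n) k) (hf : f ∈ toricIdeal k d) :
    ind k W (p * f) = constantCoeff p * ind k W f := by
  induction p using MvPolynomial.induction_on generalizing f with
  | C a => rw [← smul_eq_C_mul, map_smul]; simp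
  | add p q hp hq => rw [add_mul, map_add, hp f hf, hq f hf, map_add, add_mul]
  | mul_X p i hp =>
    rw [mul_assoc, hp _ (Ideal.mul_mem_left _ _ hf), ind_X k d W hW i f hf]; simp

lemma family (k : Type*) [Field k] {n m : ℕ} (d : Fin n → ℕ) (g : Fin m → MvPolynomial (Fin n) k)
    (hg : Ideal.span (Set.range g) = toricIdeal k d) {ι : Type*} [Fintype ι]
    (W : ι → Set (Fin n → ℕ)) (x y : ι → (Fin n → ℕ)) (hW : ∀ i, Closed d (W i))
    (hx : ∀ i, x i ∈ W i) (hdis : ∀ i j, i ≠ j → x i ∉ W j) (hy : ∀ i j, y i ∉ W j)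
    (hxy : ∀ i, dg d (x i) = dg d (y i)) : Fintype.card ι ≤ m := by
  classical
  let Φ : MvPolynomial (Fin n) k →ₗ[k] (ι → k) := LinearMap.pi (fun i => ind k (W i))
  let S : Submodule k (ι → k) := Submodule.span k (Set.range (fun j => Φ (g j)))
  have hgm : ∀ j, g j ∈ toricIdeal k d := fun j => hg ▸ Ideal.subset_span ⟨j, rfl⟩
  have h1 : ∀ f ∈ toricIdeal k d, Φ f ∈ S := by
    intro f hf
    rw [← hg, Ideal.mem_span_range_iff_exists_fun] at hf
    obtain ⟨c, rfl⟩ := hf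
    rw [map_sum]
    refine Submodule.sum_mem _ (fun j _ => ?_)
    have : Φ (c j * g j) = constantCoeff (c j) • Φ (g j) := by
      ext i
      simp only [Φ, LinearMap.pi_apply, Pi.smul_apply, smul_eq_mul]
      exact ind_mul k d (W i) (hW i) _ _ (hgm j)
    rw [this]
    exact Submodule.smul_mem _ _ (Submodule.subset_span ⟨j, rfl⟩)
  have h2 : S = ⊤ := by
    rw [eq_top_iff, ← (Pi.basisFun k ι).span_eq, Submodule.span_le]
    rintro _ ⟨i, rfl⟩
    have := h1 _ (binom_mem k d (x i) (y i) (hxy i))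
    suffices hh : (Pi.basisFun k ι) i = Φ (mo k (x i) - mo k (y i)) by
      rw [hh]; exact this
    ext j
    simp only [Pi.basisFun_apply, Φ, LinearMap.pi_apply, map_sub, ind_mo, hy i j, if_false, sub_zero]
    by_cases h : i = j
    · subst h; simp [hx i]
    · simp [hdis i j h, Pi.single_apply, Ne.symm h]
  have h3 := finrank_range_le_card (R := k) (fun j => Φ (g j))
  rw [Set.finrank] at h3
  change Module.finrank k S ≤ _ at h3
  rw [h2, finrank_top] at h3
  simpa using h3


lemma dg_succAbove {n : ℕ} (d u : Fin (n + 1) → ℕ) (j : Fin (n + 1)) :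
    dg d u = u j * d j + dg (fun i => d (j.succAbove i)) (fun i => u (j.succAbove i)) := by
  rw [dg, dg, Fin.sum_univ_succAbove _ j]

/-- gluing one element -/
lemma glue (k : Type*) [Field k] {n : ℕ} (d : Fin (n + 2) → ℕ) (j : Fin (n + 2))
    (hci : IsCI k (fun i => d (j.succAbove i))) (m : ℕ) (β : Fin (n + 1) → ℕ)
    (hβ : m * d j = dg (fun i => d (j.succAbove i)) β)
    (hdiv : ∀ v : Fin (n + 2) → ℤ, ∑ i, v i * (d i : ℤ) = 0 → (m : ℤ) ∣ v j) :
    IsCI k d := by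
  obtain ⟨g, hg⟩ := hci
  set d' : Fin (n + 1) → ℕ := fun i => d (j.succAbove i) with hd'
  let ρ : MvPolynomial (Fin (n + 1)) k →ₐ[k] MvPolynomial (Fin (n + 2)) k := rename j.succAbove
  let r : MvPolynomial (Fin (n + 2)) k := X j ^ m - ρ (mo k β)
  let G : Fin (n + 1) → MvPolynomial (Fin (n + 2)) k := Fin.cons r (fun i => ρ (g i))
  refine ⟨G, ?_⟩
  change Ideal.span (Set.range G) = _
  have hmo : ∀ u : Fin (n + 2) → ℕ, mo k u = X j ^ u j * ρ (mo k (fun i => u (j.succAbove i))) := by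
    intro u
    rw [mo, mo, Fin.prod_univ_succAbove _ j]
    simp [ρ]
  have hae : ∀ f, aeval (fun i => (Polynomial.X : Polynomial k) ^ d i) (ρ f) =
      aeval (fun i => (Polynomial.X : Polynomial k) ^ d' i) f := by
    intro f
    simp only [ρ, aeval_rename]
    rfl
  have hr : r ∈ Ideal.span (Set.range G) := Ideal.subset_span ⟨0, by simp [G]⟩
  have hgi : ∀ f ∈ toricIdeal k d', ρ f ∈ Ideal.span (Set.range G) := by
    intro f hf
    rw [← hg] at hf
    have := Ideal.mem_map_of_mem ρ hf
    rw [Ideal.map_span] at this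
    refine Ideal.span_mono ?_ this
    rintro _ ⟨_, ⟨i, rfl⟩, rfl⟩
    exact ⟨i.succ, by simp [G]⟩
  apply le_antisymm
  · rw [Ideal.span_le]
    rintro _ ⟨i, rfl⟩
    refine Fin.cases ?_ (fun i => ?_) i
    · change aeval _ r = 0
      simp only [r, map_sub, hae, aeval_mo, map_pow, aeval_X, ← hβ]
      rw [← pow_mul, mul_comm, sub_self]
    · change aeval _ (ρ (g i)) = 0
      rw [hae, ← mem_toric, ← hg]
      exact Ideal.subset_span ⟨i, rfl⟩
  · apply toric_le
    intro u w huw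
    set J := Ideal.span (Set.range G) with hJ
    have hd : (m : ℤ) ∣ (u j : ℤ) - w j := by
      have := hdiv (fun i => (u i : ℤ) - w i) (by
        have : ((dg d u : ℕ) : ℤ) = dg d w := by rw [huw]
        simp only [dg, Nat.cast_sum, Nat.cast_mul] at this
        simp only [sub_mul, Finset.sum_sub_distrib, this, sub_self])
      exact this
    have hmod : u j % m = w j % m := by
      have := (Nat.modEq_iff_dvd.2 hd)
      exact this.symm
    have key : ∀ u : Fin (n + 2) → ℕ, mo k u - X j ^ (u j % m) *
        ρ (mo k ((u j / m) • β + (fun i => u (j.succAbove i)))) ∈ J := by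
      intro u
      have h1 : (X j ^ m) ^ (u j / m) - (ρ (mo k β)) ^ (u j / m) ∈ J :=
        Ideal.mem_of_dvd _ (sub_dvd_pow_sub_pow _ _ _) hr
      have h2 : mo k ((u j / m) • β) = (mo k β) ^ (u j / m) := by
        simp [mo, ← Finset.prod_pow, ← pow_mul, mul_comm]
      have h3 := J.mul_mem_left (X j ^ (u j % m) * ρ (mo k (fun i => u (j.succAbove i)))) h1
      convert h3 using 1
      rw [hmo u, mo_add, map_mul, h2, map_pow]
      nth_rewrite 1 [← Nat.mod_add_div (u j) m]
      rw [pow_add, pow_mul]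
      ring
    have hdeg : ∀ u : Fin (n + 2) → ℕ, dg d u = (u j % m) * d j +
        dg d' ((u j / m) • β + (fun i => u (j.succAbove i))) := by
      intro u
      rw [dg_succAbove d u j, dg_add]
      have : dg d' ((u j / m) • β) = (u j / m) * (m * d j) := by
        rw [hβ]; simp [dg, Finset.mul_sum, mul_assoc]
      rw [this]
      nth_rewrite 1 [← Nat.mod_add_div (u j) m]
      ring
    have h4 : dg d' ((u j / m) • β + (fun i => u (j.succAbove i))) =
        dg d' ((w j / m) • β + (fun i => w (j.succAbove i))) := by
      have := hdeg u
      rw [huw, hdeg w, hmod] at this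
      omega
    have h5 := J.mul_mem_left (X j ^ (u j % m)) (hgi _ (binom_mem k d' _ _ h4))
    have h6 := J.sub_mem (J.add_mem (key u) h5) (key w)
    convert h6 using 1
    rw [map_sub, hmod]
    ring

lemma ci_one (k : Type*) [Field k] (d : Fin 1 → ℕ) (hd : ∀ i, 0 < d i) : IsCI k d := by
  refine ⟨fun i => i.elim0, ?_⟩
  apply le_antisymm
  · rw [Ideal.span_le]
    rintro _ ⟨i, rfl⟩
    exact i.elim0
  · apply toric_le
    intro u w h
    have : u = w := by
      ext i
      fin_cases i
      simp only [dg, Fin.sum_univ_one] at h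
      exact Nat.eq_of_mul_eq_mul_right (hd 0) h
    simp [this]

lemma ci_two (k : Type*) [Field k] (d : Fin 2 → ℕ) (hd : ∀ i, 0 < d i) : IsCI k d := by
  have hg : 0 < Nat.gcd (d 0) (d 1) := Nat.gcd_pos_of_pos_left _ (hd 0)
  refine glue k d 0 (ci_one k _ (fun i => hd _)) (d 1 / Nat.gcd (d 0) (d 1))
    (fun _ => d 0 / Nat.gcd (d 0) (d 1)) ?_ ?_
  · simp only [dg, Fin.sum_univ_one]
    change _ = _ * d 1
    have h0 := Nat.div_mul_cancel (Nat.gcd_dvd_left (d 0) (d 1))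
    have h1 := Nat.div_mul_cancel (Nat.gcd_dvd_right (d 0) (d 1))
    generalize Nat.gcd (d 0) (d 1) = g at *
    generalize d 0 / g = x at *
    generalize d 1 / g = y at *
    rw [← h0, ← h1]; ring
  · intro v hv
    rw [Fin.sum_univ_two] at hv
    have hco := Nat.coprime_div_gcd_div_gcd hg
    have h0 := Nat.div_mul_cancel (Nat.gcd_dvd_left (d 0) (d 1))
    have h1 := Nat.div_mul_cancel (Nat.gcd_dvd_right (d 0) (d 1))
    generalize Nat.gcd (d 0) (d 1) = g at *
    generalize d 0 / g = x at *
    generalize d 1 / g = y at *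
    rw [← h0, ← h1] at hv
    push_cast at hv
    have h2 : v 0 * (x : ℤ) = -(v 1) * y := by
      have : (g : ℤ) ≠ 0 := by positivity
      apply mul_right_cancel₀ this
      linarith
    have h3 : (y : ℤ) ∣ v 0 * x := ⟨-(v 1), by rw [h2]; ring⟩
    exact (Nat.Coprime.isCoprime hco).symm.dvd_of_dvd_mul_right h3


/-- isolated monomials -/
def Iso {n : ℕ} (d t : Fin n → ℕ) : Prop :=
  ∀ w, dg d t = dg d w → (∃ j, 0 < t j ∧ 0 < w j) → w = t

lemma Iso.closed {n : ℕ} {d t : Fin n → ℕ} (h : Iso d t) : Closed d {t} := by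
  rintro u rfl w h1 h2
  exact h w h1 h2

lemma bound_succ (k : Type*) [Field k] {n : ℕ} {d : Fin n → ℕ} (hci : IsCI k d)
    (T : Finset (Fin n → ℕ)) (W : Set (Fin n → ℕ)) (hW : Closed d W)
    (hT : ∀ t ∈ T, Iso d t ∧ t ∉ W ∧ ∃ w, dg d t = dg d w ∧ w ∉ T ∧ w ∉ W)
    (x y : Fin n → ℕ) (hx : x ∈ W) (hy : y ∉ W) (hyT : y ∉ T) (hxy : dg d x = dg d y) :
    T.card + 1 ≤ n - 1 := by
  obtain ⟨g, hg⟩ := hci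
  choose! w hw using fun t ht => (hT t ht).2.2
  have := family k d g hg (ι := Option T) (fun i => i.elim W (fun t => {t.1}))
    (fun i => i.elim x (fun t => t.1)) (fun i => i.elim y (fun t => w t.1)) ?_ ?_ ?_ ?_ ?_
  · simpa using this
  · rintro (_ | t)
    · exact hW
    · exact (hT t.1 t.2).1.closed
  · rintro (_ | t)
    · exact hx
    · simp
  · rintro (_ | t) (_ | t') hne
    · simp at hne
    · simp only [Option.elim, Set.mem_singleton_iff]
      rintro rfl
      exact (hT t'.1 t'.2).2.1 hx
    · exact (hT t.1 t.2).2.1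
    · simp only [Option.elim, Set.mem_singleton_iff]
      intro h
      exact hne (by rw [Subtype.ext h])
  · rintro (_ | t) (_ | t')
    · exact hy
    · simp only [Option.elim, Set.mem_singleton_iff]
      rintro rfl
      exact hyT t'.2
    · exact (hw t.1 t.2).2.2
    · simp only [Option.elim, Set.mem_singleton_iff]
      intro h
      exact (hw t.1 t.2).2.1 (h ▸ t'.2)
  · rintro (_ | t)
    · exact hxy
    · exact (hw t.1 t.2).1

lemma ext_bound (k : Type*) [Field k] {n : ℕ} {d : Fin n → ℕ} (hci : IsCI k d)
    (T : Finset (Fin n → ℕ)) (z z' : Fin n → ℕ) (hz : Iso d z) (hzT : z ∉ T)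
    (hz' : z' ≠ z) (hzz : dg d z = dg d z')
    (hT : ∀ t ∈ T, Iso d t ∧ ∃ w, dg d t = dg d w ∧ w ∉ T ∧ w ≠ z) :
    T.card + 1 ≤ n - 1 := by
  by_cases h : z' ∈ T
  · obtain ⟨_, w, h1, h2, h3⟩ := hT z' h
    refine bound_succ k hci T {z} hz.closed (fun t ht => ⟨(hT t ht).1, ?_, (hT t ht).2⟩)
      z w rfl h3 h2 (hzz.trans h1)
    rintro rfl; exact hzT ht
  · refine bound_succ k hci T {z} hz.closed (fun t ht => ⟨(hT t ht).1, ?_, (hT t ht).2⟩)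
      z z' rfl hz' h hzz
    rintro rfl; exact hzT ht

lemma split_pos {n : ℕ} (u : Fin n → ℕ) (j : Fin n) (h : 0 < u j) :
    ∃ u' : Fin n → ℕ, u = Pi.single j 1 + u' := by
  refine ⟨u - Pi.single j 1, ?_⟩
  ext i
  by_cases hi : i = j
  · subst hi; simp; omega
  · simp [hi]

lemma dg_single {n : ℕ} (d : Fin n → ℕ) (j : Fin n) (m : ℕ) : dg d (Pi.single j m) = m * d j := by
  rw [dg, Finset.sum_eq_single j]
  · simp
  · intro b _ hb; simp [hb]
  · simp

lemma dg_eq_zero {n : ℕ} {d : Fin n → ℕ} (hpos : ∀ i, 0 < d i) (u : Fin n → ℕ) (h : dg d u = 0) :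
    u = 0 := by
  ext i
  have := (Finset.sum_eq_zero_iff.1 h) i (Finset.mem_univ i)
  have h2 := hpos i
  simp only [mul_eq_zero] at this
  simp only [Pi.zero_apply]
  omega

lemma functional (k : Type*) [Field k] {n : ℕ} {d : Fin n → ℕ} (hpos : ∀ i, 0 < d i)
    (hci : IsCI k d) {G : Type*} [AddCommGroup G] (f : (Fin n → ℕ) →+ G)
    (T : Finset (Fin n → ℕ)) (hc : n - 1 ≤ T.card) (w : (Fin n → ℕ) → (Fin n → ℕ))
    (hT : ∀ t ∈ T, Iso d t ∧ dg d t = dg d (w t) ∧ w t ∉ T ∧ f t = f (w t))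
    (hw : ∀ t ∈ T, ∀ t' ∈ T, dg d t = dg d t' → w t = w t') :
    ∀ b u v, dg d u = b → dg d v = b → f u = f v := by
  intro b
  induction b using Nat.strong_induction_on with
  | _ b ih =>
  intro u v hu hv
  have hcl : ∀ c : G, Closed d {z | dg d z = b ∧ f z = c} := by
    rintro c z ⟨h1, h2⟩ z' h3 ⟨j, h4, h5⟩
    refine ⟨h3 ▸ h1, ?_⟩
    obtain ⟨y, rfl⟩ := split_pos z j h4
    obtain ⟨y', rfl⟩ := split_pos z' j h5
    rw [dg_add, dg_add] at h3
    rw [dg_add, dg_single] at h1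
    have := hpos j
    have h6 := ih (dg d y) (by omega) y y' rfl (by omega)
    rw [← h2, map_add, map_add, h6]
  by_cases hex : ∃ t ∈ T, dg d t = b
  · obtain ⟨t, htT, htb⟩ := hex
    have hwt : dg d (w t) = b := by rw [← (hT t htT).2.1, htb]
    have key : ∀ z, dg d z = b → f z = f (w t) := by
      intro z hz
      by_contra hne
      have hfT : ∀ t' ∈ T, dg d t' = b → w t' = w t := fun t' h h' =>
        hw t' h t htT (by rw [h', htb])
      have := bound_succ k hci T _ (hcl (f z)) ?_ z (w t) ⟨hz, rfl⟩ (fun h => hne h.2.symm)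
        (hT t htT).2.2.1 (by rw [hz, hwt])
      · omega
      · intro t' ht'
        obtain ⟨h1, h2, h3, h4⟩ := hT t' ht'
        refine ⟨h1, ?_, w t', h2, h3, ?_⟩
        · rintro ⟨h5, h6⟩
          rw [← hfT t' ht' h5, ← h6] at hne
          exact hne h4
        · rintro ⟨h5, h6⟩
          rw [← hfT t' ht' (h2.trans h5), ← h6] at hne
          exact hne rfl
    rw [key u hu, key v hv]
  · by_contra hne
    have := bound_succ k hci T _ (hcl (f u)) ?_ u v ⟨hu, rfl⟩ (fun h => hne h.2.symm)
        (fun h => hex ⟨v, h, hv⟩) (by rw [hu, hv])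
    · omega
    · intro t' ht'
      obtain ⟨h1, h2, h3, h4⟩ := hT t' ht'
      refine ⟨h1, fun h => hex ⟨t', ht', h.1⟩, w t', h2, h3, fun h => hex ⟨t', ht', ?_⟩⟩
      rw [h2, h.1]

lemma uniq_single {n : ℕ} {d : Fin n → ℕ} (hpos : ∀ i, 0 < d i) (hmin : MinimallyGenerates d)
    (i : Fin n) (w : Fin n → ℕ) (h : dg d w = d i) : w = Pi.single i 1 := by
  by_cases hi : w i = 0
  · exact absurd ⟨w, hi, h.symm⟩ (hmin i)
  · obtain ⟨y, rfl⟩ := split_pos w i (by omega)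
    rw [dg_add, dg_single] at h
    rw [dg_eq_zero hpos y (by omega), add_zero]

lemma iso_pair {n : ℕ} {d : Fin n → ℕ} (hpos : ∀ i, 0 < d i) (hmin : MinimallyGenerates d)
    (i j : Fin n) : Iso d (Pi.single i 1 + Pi.single j 1) := by
  have main : ∀ i j : Fin n, ∀ w, dg d (Pi.single i 1 + Pi.single j 1) = dg d w → 0 < w i →
      w = Pi.single i 1 + Pi.single j 1 := by
    intro i j w h hw
    obtain ⟨y, rfl⟩ := split_pos w i hw
    rw [dg_add, dg_add, dg_single, dg_single] at h
    rw [uniq_single hpos hmin j y (by omega)]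
  rintro w h ⟨l, h1, h2⟩
  by_cases hi : l = i
  · subst hi; exact main _ _ _ h h2
  · by_cases hj : l = j
    · subst hj
      rw [add_comm] at h ⊢
      exact main _ _ _ h h2
    · simp [hi, hj] at h1

lemma Iso.sub {n : ℕ} {d t : Fin n → ℕ} (h : Iso d t) (s s' : Fin n → ℕ) (hs : t = s + s')
    (j : Fin n) (hj : 0 < s' j) (w : Fin n → ℕ) (hw : dg d s = dg d w) : w = s := by
  subst hs
  have := h (w + s') (by rw [dg_add, dg_add, hw]) ⟨j, by simp; omega⟩
  exact add_right_cancel this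

lemma crit {n : ℕ} {d : Fin n → ℕ} (hpos : ∀ i, 0 < d i) (hmin : MinimallyGenerates d)
    (i j : Fin n) (hij : i ≠ j) : ∃ m, 2 ≤ m ∧ Iso d (Pi.single i m) ∧
      ∃ M, M i = 0 ∧ dg d (Pi.single i m) = dg d M := by
  classical
  have hex : ∃ m, 0 < m ∧ ∃ M, M i = 0 ∧ dg d (Pi.single i m) = dg d M :=
    ⟨d j, hpos j, Pi.single j (d i), by simp [hij], by rw [dg_single, dg_single, mul_comm]⟩
  obtain ⟨h0, M, hM, hM'⟩ := Nat.find_spec hex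
  have hlt := fun m' => Nat.find_min hex (m := m')
  generalize Nat.find hex = m at *
  refine ⟨m, ?_, ?_, M, hM, hM'⟩
  · by_contra h
    have : m = 1 := by omega
    subst this
    exact hmin i ⟨M, hM, by rw [dg_single, one_mul] at hM'; exact hM'⟩
  · rintro w h ⟨l, h1, h2⟩
    have hl : l = i := by
      by_contra hne; simp [hne] at h1
    subst hl
    have hw : w = Pi.single l (w l) + Function.update w l 0 := by
      ext x
      by_cases hx : x = l
      · subst hx; simp
      · simp [hx]
    have hdeg : dg d w = w l * d l + dg d (Function.update w l 0) := by
      conv_lhs => rw [hw]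
      rw [dg_add, dg_single]
    rw [dg_single, hdeg] at h
    by_cases hlm : w l < m
    · exfalso
      refine hlt (m - w l) (by omega) ⟨by omega, Function.update w l 0, by simp, ?_⟩
      rw [dg_single, Nat.sub_mul]; omega
    · have h3 : m * d l ≤ w l * d l := Nat.mul_le_mul_right _ (by omega)
      have h4 : dg d (Function.update w l 0) = 0 := by omega
      rw [h4, add_zero] at h
      rw [hw, dg_eq_zero hpos _ h4, add_zero, Nat.eq_of_mul_eq_mul_right (hpos l) h]

lemma big (k : Type*) [Field k] (n : ℕ) (d : Fin n → ℕ)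
    (hn : 5 ≤ n) (hpos : ∀ i, 0 < d i) (h e : ℕ) (hh : 0 < h) (he : 0 < e)
    (hga : ∀ i : ℕ, 0 < i → ∀ hi : i + 1 < n, d ⟨i, by omega⟩ = h * d ⟨0, by omega⟩ + i * e)
    (hmin : MinimallyGenerates d) (hci : IsCI k d) : False := by
  classical
  let E : ℕ → ℕ → Fin n → ℕ := fun m i => if hi : i < n then Pi.single ⟨i, hi⟩ m else 0
  have hE : ∀ m i (hi : i < n), E m i = Pi.single ⟨i, hi⟩ m := fun m i hi => by simp [E, hi]
  have hEv : ∀ m i x (hx : x < n), E m i ⟨x, hx⟩ = if x = i then m else 0 := by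
    intro m i x hx
    simp only [E]
    split_ifs with h1 h2 h2
    · subst h2; simp
    · rw [Pi.single_eq_of_ne]; simpa using h2
    · omega
    · rfl
  have hdE : ∀ m i, 0 < i → i + 1 < n → dg d (E m i) = m * (h * d ⟨0, by omega⟩ + i * e) := by
    intro m i h0 h1
    rw [hE _ _ (by omega), dg_single, hga i h0 h1]
  have hdE0 : ∀ m, dg d (E m 0) = m * d ⟨0, by omega⟩ := by
    intro m
    rw [hE _ _ (by omega), dg_single]
  let t : ℕ → Fin n → ℕ := fun s => E 1 (s / 2) + E 1 (s - s / 2)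
  let w : ℕ → Fin n → ℕ := fun s => (if s / 2 = 1 then E h 0 else E 1 (s / 2 - 1)) + E 1 (s - s / 2 + 1)
  let R := Finset.Icc 2 (2 * n - 6)
  have hdt : ∀ s ∈ R, dg d (t s) = 2 * (h * d ⟨0, by omega⟩) + s * e := by
    intro s hs
    simp only [R, Finset.mem_Icc] at hs
    simp only [t]
    rw [dg_add, hdE _ _ (by omega) (by omega), hdE _ _ (by omega) (by omega)]
    have : s = s / 2 + (s - s / 2) := by omega
    conv_rhs => rw [this]
    ring
  have hdw : ∀ s ∈ R, dg d (w s) = 2 * (h * d ⟨0, by omega⟩) + s * e := by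
    intro s hs
    simp only [R, Finset.mem_Icc] at hs
    simp only [w]
    rw [dg_add, hdE _ (s - s / 2 + 1) (by omega) (by omega)]
    split_ifs with h1
    · rw [hdE0]
      have : s = (s - s / 2 + 1) := by omega
      conv_rhs => rw [this]
      ring
    · rw [hdE _ _ (by omega) (by omega)]
      have : s = (s / 2 - 1) + (s - s / 2 + 1) := by omega
      conv_rhs => rw [this]
      ring
  have hinj : ∀ s ∈ R, ∀ s' ∈ R, dg d (t s) = dg d (t s') → s = s' := by
    intro s hs s' hs' hh
    rw [hdt s hs, hdt s' hs'] at hh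
    exact Nat.eq_of_mul_eq_mul_right he (by omega)
  have hwt : ∀ s ∈ R, w s ≠ t s := by
    intro s hs heq
    simp only [R, Finset.mem_Icc] at hs
    have := congrFun heq ⟨s - s / 2 + 1, by omega⟩
    simp only [t, w, Pi.add_apply, hEv] at this
    rw [if_pos trivial, if_neg (show ¬ (s - s / 2 + 1 = s / 2) by omega),
      if_neg (show ¬ (s - s / 2 + 1 = s - s / 2) by omega)] at this
    omega
  let T := R.image t
  have hTc : T.card = 2 * n - 7 := by
    rw [Finset.card_image_of_injOn, Nat.card_Icc]
    · omega
    · intro s hs s' hs' heq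
      exact hinj s hs s' hs' (by rw [heq])
  have hwT : ∀ s ∈ R, w s ∉ T := by
    intro s hs hmem
    obtain ⟨s', hs', heq⟩ := Finset.mem_image.1 hmem
    have : s' = s := hinj s' hs' s hs (by rw [heq, hdw s hs, hdt s hs])
    subst this
    exact hwt _ hs heq.symm
  have hTiso : ∀ s ∈ R, Iso d (t s) := by
    intro s hs
    simp only [R, Finset.mem_Icc] at hs
    simp only [t]
    rw [hE _ _ (by omega), hE _ _ (by omega)]
    exact iso_pair hpos hmin _ _
  obtain ⟨m4, hm4, hi4, M4, hM4, hM4'⟩ := crit hpos hmin ⟨n - 1, by omega⟩ ⟨0, by omega⟩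
    (by simp; omega)
  obtain ⟨m3, hm3, hi3, M3, hM3, hM3'⟩ := crit hpos hmin ⟨n - 2, by omega⟩ ⟨0, by omega⟩
    (by simp; omega)
  obtain ⟨m0, hm0, hi0, M0, hM0, hM0'⟩ := crit hpos hmin ⟨0, by omega⟩ ⟨n - 1, by omega⟩
    (by simp; omega)
  rw [← hE _ _ (by omega)] at hi4 hM4' hi3 hM3' hi0 hM0'
  have hz4T : E m4 (n - 1) ∉ T := by
    intro hmem
    obtain ⟨s, hs, heq⟩ := Finset.mem_image.1 hmem
    simp only [R, Finset.mem_Icc] at hs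
    have := congrFun heq ⟨n - 1, by omega⟩
    simp only [t, Pi.add_apply, hEv] at this
    split_ifs at this <;> omega
  have hz4w : ∀ s ∈ R, w s ≠ E m4 (n - 1) := by
    intro s hs heq
    simp only [R, Finset.mem_Icc] at hs
    have := congrFun heq ⟨s - s / 2 + 1, by omega⟩
    simp only [w, Pi.add_apply, hEv] at this
    rw [if_pos trivial, if_neg (show ¬ (s - s / 2 + 1 = n - 1) by omega)] at this
    omega
  have hz3T : E m3 (n - 2) ∉ T := by
    intro hmem
    obtain ⟨s, hs, heq⟩ := Finset.mem_image.1 hmem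
    simp only [R, Finset.mem_Icc] at hs
    have := congrFun heq ⟨n - 2, by omega⟩
    simp only [t, Pi.add_apply, hEv] at this
    split_ifs at this <;> omega
  have hz3w : ∀ s ∈ R, w s ≠ E m3 (n - 2) := by
    intro s hs heq
    simp only [R, Finset.mem_Icc] at hs
    have := congrFun heq ⟨s / 2 - 1, by omega⟩
    simp only [w, Pi.add_apply, hEv] at this
    rw [if_neg (show ¬ (s / 2 - 1 = n - 2) by omega)] at this
    split_ifs at this with h1
    all_goals first | omega | (rw [hEv, if_pos (by omega)] at this; omega)
  have hz0T : E m0 0 ∉ T := by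
    intro hmem
    obtain ⟨s, hs, heq⟩ := Finset.mem_image.1 hmem
    simp only [R, Finset.mem_Icc] at hs
    have := congrFun heq ⟨0, by omega⟩
    simp only [t, Pi.add_apply, hEv] at this
    split_ifs at this <;> omega
  have hz0w : ∀ s ∈ R, w s ≠ E m0 0 := by
    intro s hs heq
    simp only [R, Finset.mem_Icc] at hs
    have := congrFun heq ⟨s - s / 2 + 1, by omega⟩
    simp only [w, Pi.add_apply, hEv] at this
    rw [if_pos trivial, if_neg (show ¬ (s - s / 2 + 1 = 0) by omega)] at this
    omega
  have hw4 : ∃ w4, dg d (E m4 (n - 1)) = dg d w4 ∧ w4 ∉ T ∧ w4 ≠ E m4 (n - 1) := by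
    by_cases hmem : M4 ∈ T
    · obtain ⟨s, hs, heq⟩ := Finset.mem_image.1 hmem
      exact ⟨w s, by rw [hM4', ← heq, hdt s hs, hdw s hs], hwT s hs, hz4w s hs⟩
    · refine ⟨M4, hM4', hmem, ?_⟩
      rintro rfl
      rw [hEv, if_pos rfl] at hM4
      omega
  obtain ⟨w4, hw4d, hw4T, hw4n⟩ := hw4
  have fin : ∀ y M, Iso d y → y ∉ T → y ≠ E m4 (n - 1) → (∀ s ∈ R, w s ≠ y) → w4 ≠ y →
      dg d y = dg d M → M ≠ y → False := by
    intro y M h1 h2 h3 h4 h5 h6 h7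
    have := ext_bound k hci (insert (E m4 (n - 1)) T) y M h1 (by simp [h2, h3]) h7 h6 ?_
    · rw [Finset.card_insert_of_notMem hz4T, hTc] at this
      omega
    · intro x hx
      rcases Finset.mem_insert.1 hx with rfl | hx
      · exact ⟨hi4, w4, hw4d, by simp [hw4T, hw4n], h5⟩
      · obtain ⟨s, hs, rfl⟩ := Finset.mem_image.1 hx
        refine ⟨hTiso s hs, w s, by rw [hdt s hs, hdw s hs], ?_, h4 s hs⟩
        simp [hwT s hs, hz4w s hs]
  by_cases hc : w4 = E m0 0
  · refine fin (E m3 (n - 2)) M3 hi3 hz3T ?_ hz3w ?_ hM3' ?_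
    · intro heq
      have := congrFun heq ⟨n - 1, by omega⟩
      simp only [hEv] at this
      split_ifs at this <;> omega
    · intro heq
      rw [hc] at heq
      have := congrFun heq ⟨0, by omega⟩
      simp only [hEv] at this
      split_ifs at this <;> omega
    · rintro rfl
      rw [hEv, if_pos rfl] at hM3
      omega
  · refine fin (E m0 0) M0 hi0 hz0T ?_ hz0w hc hM0' ?_
    · intro heq
      have := congrFun heq ⟨n - 1, by omega⟩
      simp only [hEv] at this
      split_ifs at this <;> omega
    · rintro rfl
      rw [hEv, if_pos rfl] at hM0
      omega


lemma functionalZ (k : Type*) [Field k] {n : ℕ} {d : Fin n → ℕ} (hpos : ∀ i, 0 < d i)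
    (hci : IsCI k d) (c : Fin n → ℤ) (N : ℕ)
    (T : Finset (Fin n → ℕ)) (hc : n - 1 ≤ T.card) (w : (Fin n → ℕ) → (Fin n → ℕ))
    (hT : ∀ t ∈ T, Iso d t ∧ dg d t = dg d (w t) ∧ w t ∉ T ∧
      (N : ℤ) ∣ (∑ i, c i * t i) - ∑ i, c i * (w t i))
    (hw : ∀ t ∈ T, ∀ t' ∈ T, dg d t = dg d t' → w t = w t')
    (v : Fin n → ℤ) (hv : ∑ i, v i * (d i : ℤ) = 0) : (N : ℤ) ∣ ∑ i, c i * v i := by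
  let f : (Fin n → ℕ) →+ ZMod N :=
    { toFun := fun u => ((∑ i, c i * (u i : ℤ) : ℤ) : ZMod N)
      map_zero' := by simp
      map_add' := by
        intro a b
        rw [← Int.cast_add, ← Finset.sum_add_distrib]
        congr 1
        apply Finset.sum_congr rfl
        intro i _
        simp only [Pi.add_apply, Nat.cast_add]
        ring }
  have hf : ∀ u, f u = ((∑ i, c i * (u i : ℤ) : ℤ) : ZMod N) := fun _ => rfl
  have key := functional k hpos hci f T hc w (fun t ht => by
    obtain ⟨h1, h2, h3, h4⟩ := hT t ht
    refine ⟨h1, h2, h3, ?_⟩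
    rw [hf, hf, ← sub_eq_zero, ← Int.cast_sub, CharP.intCast_eq_zero_iff (ZMod N) N]
    exact h4) hw
  let p : Fin n → ℕ := fun i => (v i).toNat
  let q : Fin n → ℕ := fun i => (-v i).toNat
  have hpq : ∀ i, v i = (p i : ℤ) - q i := by intro i; simp only [p, q]; omega
  have hdeg : dg d p = dg d q := by
    zify [dg]
    have : ∑ i, v i * (d i : ℤ) = ∑ i, (p i : ℤ) * d i - ∑ i, (q i : ℤ) * d i := by
      rw [← Finset.sum_sub_distrib]
      exact Finset.sum_congr rfl (fun i _ => by rw [hpq i]; ring)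
    push_cast
    linarith
  have h2 := key _ p q rfl hdeg.symm
  rw [hf, hf, ← sub_eq_zero, ← Int.cast_sub, CharP.intCast_eq_zero_iff (ZMod N) N,
    ← Finset.sum_sub_distrib] at h2
  convert h2 using 1
  exact Finset.sum_congr rfl (fun i _ => by rw [hpq i]; ring)

lemma veq {α : Type*} (a b c e p q r s : α) :
    (![a, b, c, e] = ![p, q, r, s]) ↔ (a = p ∧ b = q ∧ c = r ∧ e = s) := by
  simp [funext_iff, Fin.forall_fin_succ]

lemma eta4 {α : Type*} (w : Fin 4 → α) : ∃ p q r s, w = ![p, q, r, s] :=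
  ⟨w 0, w 1, w 2, w 3, by ext i; fin_cases i <;> rfl⟩

lemma dg4 (d : Fin 4 → ℕ) (p q r s : ℕ) :
    dg d ![p, q, r, s] = p * d 0 + q * d 1 + r * d 2 + s * d 3 := by
  simp [dg, Fin.sum_univ_four]

lemma iso_use {d : Fin 4 → ℕ} {a b c e : ℕ} (h : Iso d ![a, b, c, e]) (p q r s : ℕ)
    (hd : a * d 0 + b * d 1 + c * d 2 + e * d 3 = p * d 0 + q * d 1 + r * d 2 + s * d 3)
    (hs : 0 < a ∧ 0 < p ∨ 0 < b ∧ 0 < q ∨ 0 < c ∧ 0 < r ∨ 0 < e ∧ 0 < s) :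
    p = a ∧ q = b ∧ r = c ∧ s = e := by
  rw [← veq]
  apply h _ (by rw [dg4, dg4, hd])
  rcases hs with hs | hs | hs | hs
  · exact ⟨0, hs⟩
  · exact ⟨1, hs⟩
  · exact ⟨2, hs⟩
  · exact ⟨3, hs⟩

lemma iso_mk {d : Fin 4 → ℕ} {a b c e : ℕ} (h : ∀ p q r s : ℕ,
    a * d 0 + b * d 1 + c * d 2 + e * d 3 = p * d 0 + q * d 1 + r * d 2 + s * d 3 →
    (0 < a ∧ 0 < p ∨ 0 < b ∧ 0 < q ∨ 0 < c ∧ 0 < r ∨ 0 < e ∧ 0 < s) →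
    p = a ∧ q = b ∧ r = c ∧ s = e) : Iso d ![a, b, c, e] := by
  intro w hd hs
  obtain ⟨p, q, r, s, rfl⟩ := eta4 w
  rw [veq]
  rw [dg4, dg4] at hd
  apply h _ _ _ _ hd
  obtain ⟨j, hj⟩ := hs
  fin_cases j
  · exact Or.inl hj
  · exact Or.inr (Or.inl hj)
  · exact Or.inr (Or.inr (Or.inl hj))
  · exact Or.inr (Or.inr (Or.inr hj))

lemma single0 (m : ℕ) : (Pi.single 0 m : Fin 4 → ℕ) = ![m, 0, 0, 0] := by
  ext i; fin_cases i <;> simp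
lemma single1 (m : ℕ) : (Pi.single 1 m : Fin 4 → ℕ) = ![0, m, 0, 0] := by
  ext i; fin_cases i <;> simp
lemma single2 (m : ℕ) : (Pi.single 2 m : Fin 4 → ℕ) = ![0, 0, m, 0] := by
  ext i; fin_cases i <;> simp
lemma single3 (m : ℕ) : (Pi.single 3 m : Fin 4 → ℕ) = ![0, 0, 0, m] := by
  ext i; fin_cases i <;> simp

lemma ext3 (k : Type*) [Field k] {d : Fin 4 → ℕ} (hci : IsCI k d)
    (t1 t2 t3 w1 w2 w3 z z' : Fin 4 → ℕ) (i1 : Iso d t1) (i2 : Iso d t2) (i3 : Iso d t3)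
    (iz : Iso d z) (e1 : dg d t1 = dg d w1) (e2 : dg d t2 = dg d w2) (e3 : dg d t3 = dg d w3)
    (ez : dg d z = dg d z') (hz' : z' ≠ z)
    (ht : t1 ≠ t2 ∧ t1 ≠ t3 ∧ t2 ≠ t3 ∧ z ≠ t1 ∧ z ≠ t2 ∧ z ≠ t3)
    (hw1 : w1 ≠ t1 ∧ w1 ≠ t2 ∧ w1 ≠ t3 ∧ w1 ≠ z)
    (hw2 : w2 ≠ t1 ∧ w2 ≠ t2 ∧ w2 ≠ t3 ∧ w2 ≠ z)
    (hw3 : w3 ≠ t1 ∧ w3 ≠ t2 ∧ w3 ≠ t3 ∧ w3 ≠ z) : False := by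
  classical
  obtain ⟨h1, h2, h3, h4, h5, h6⟩ := ht
  have := ext_bound k hci {t1, t2, t3} z z' iz (by simp [*]) hz' ez (by
    intro t ht
    simp only [Finset.mem_insert, Finset.mem_singleton] at ht
    rcases ht with rfl | rfl | rfl
    · exact ⟨i1, w1, e1, by simp [hw1], hw1.2.2.2⟩
    · exact ⟨i2, w2, e2, by simp [hw2], hw2.2.2.2⟩
    · exact ⟨i3, w3, e3, by simp [hw3], hw3.2.2.2⟩)
  rw [Finset.card_eq_three.2 ⟨t1, t2, t3, h1, h2, h3, rfl⟩] at this
  omega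

lemma fun3 (k : Type*) [Field k] {d : Fin 4 → ℕ} (hpos : ∀ i, 0 < d i) (hci : IsCI k d)
    (t1 t2 t3 w1 w2 w3 : Fin 4 → ℕ) (i1 : Iso d t1) (i2 : Iso d t2) (i3 : Iso d t3)
    (e1 : dg d t1 = dg d w1) (e2 : dg d t2 = dg d w2) (e3 : dg d t3 = dg d w3)
    (ht : t1 ≠ t2 ∧ t1 ≠ t3 ∧ t2 ≠ t3)
    (hw1 : w1 ≠ t1 ∧ w1 ≠ t2 ∧ w1 ≠ t3)
    (hw2 : w2 ≠ t1 ∧ w2 ≠ t2 ∧ w2 ≠ t3)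
    (hw3 : w3 ≠ t1 ∧ w3 ≠ t2 ∧ w3 ≠ t3)
    (h12 : dg d t1 = dg d t2 → w1 = w2) (h13 : dg d t1 = dg d t3 → w1 = w3)
    (h23 : dg d t2 = dg d t3 → w2 = w3)
    (c : Fin 4 → ℤ) (N : ℕ)
    (g1 : (N : ℤ) ∣ (∑ i, c i * t1 i) - ∑ i, c i * w1 i)
    (g2 : (N : ℤ) ∣ (∑ i, c i * t2 i) - ∑ i, c i * w2 i)
    (g3 : (N : ℤ) ∣ (∑ i, c i * t3 i) - ∑ i, c i * w3 i)
    (v : Fin 4 → ℤ) (hv : ∑ i, v i * (d i : ℤ) = 0) : (N : ℤ) ∣ ∑ i, c i * v i := by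
  classical
  obtain ⟨h1, h2, h3⟩ := ht
  let w : (Fin 4 → ℕ) → (Fin 4 → ℕ) := fun t => if t = t1 then w1 else if t = t2 then w2 else w3
  have W1 : w t1 = w1 := by simp [w]
  have W2 : w t2 = w2 := by simp [w, h1.symm]
  have W3 : w t3 = w3 := by simp [w, h2.symm, h3.symm]
  refine functionalZ k hpos hci c N {t1, t2, t3} ?_ w ?_ ?_ v hv
  · rw [Finset.card_eq_three.2 ⟨t1, t2, t3, h1, h2, h3, rfl⟩]
  · intro t ht
    simp only [Finset.mem_insert, Finset.mem_singleton] at ht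
    rcases ht with rfl | rfl | rfl
    · rw [W1]; exact ⟨i1, e1, by simp [hw1], g1⟩
    · rw [W2]; exact ⟨i2, e2, by simp [hw2], g2⟩
    · rw [W3]; exact ⟨i3, e3, by simp [hw3], g3⟩
  · intro t ht t' ht' hd
    simp only [Finset.mem_insert, Finset.mem_singleton] at ht ht'
    rcases ht with rfl | rfl | rfl <;> rcases ht' with rfl | rfl | rfl <;>
      simp only [W1, W2, W3]
    · exact h12 hd
    · exact h13 hd
    · exact (h12 hd.symm).symm
    · exact h23 hd
    · exact (h13 hd.symm).symm
    · exact (h23 hd.symm).symm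

lemma crit4 {d : Fin 4 → ℕ} (hpos : ∀ i, 0 < d i) (hmin : MinimallyGenerates d) :
    (∃ m, 2 ≤ m ∧ Iso d ![m, 0, 0, 0] ∧ ∃ q r s, m * d 0 = q * d 1 + r * d 2 + s * d 3) ∧
    (∃ m, 2 ≤ m ∧ Iso d ![0, 0, m, 0] ∧ ∃ p q s, m * d 2 = p * d 0 + q * d 1 + s * d 3) ∧
    (∃ m, 2 ≤ m ∧ Iso d ![0, 0, 0, m] ∧ ∃ p q r, m * d 3 = p * d 0 + q * d 1 + r * d 2) := by
  refine ⟨?_, ?_, ?_⟩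
  · obtain ⟨m, h1, h2, M, h3, h4⟩ := crit hpos hmin 0 1 (by simp)
    obtain ⟨p, q, r, s, rfl⟩ := eta4 M
    simp only [single0, dg4] at h2 h4
    simp at h3
    subst h3
    exact ⟨m, h1, h2, q, r, s, by linarith⟩
  · obtain ⟨m, h1, h2, M, h3, h4⟩ := crit hpos hmin 2 1 (by simp)
    obtain ⟨p, q, r, s, rfl⟩ := eta4 M
    simp only [single2, dg4] at h2 h4
    simp at h3
    subst h3
    exact ⟨m, h1, h2, p, q, s, by linarith⟩
  · obtain ⟨m, h1, h2, M, h3, h4⟩ := crit hpos hmin 3 1 (by simp)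
    obtain ⟨p, q, r, s, rfl⟩ := eta4 M
    simp only [single3, dg4] at h2 h4
    simp at h3
    subst h3
    exact ⟨m, h1, h2, p, q, r, by linarith⟩

lemma min4 {d : Fin 4 → ℕ} (hmin : MinimallyGenerates d) (p r s : ℕ) :
    d 1 ≠ p * d 0 + r * d 2 + s * d 3 := by
  intro h
  refine hmin 1 ⟨![p, 0, r, s], rfl, ?_⟩
  rw [h, Fin.sum_univ_four]
  simp

/-- first outcome -/
lemma outA {d : Fin 4 → ℕ} (m p q r : ℕ)
    (hm : m * d 3 = p * d 0 + q * d 1 + r * d 2)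
    (h3 : ∀ v : Fin 4 → ℤ, ∑ i, v i * (d i : ℤ) = 0 → (m : ℤ) ∣ v 3)
    (h1 : ∀ v : Fin 4 → ℤ, ∑ i, v i * (d i : ℤ) = 0 → v 3 = 0 → (2 : ℤ) ∣ v 1) :
    Even (d 0 / Nat.gcd (d 0) (d 1)) ∧ ∃ β₁ β₂ β₃ : ℕ,
            Nat.gcd (d 0) (d 1) * d 3 = β₁ * d 0 + β₂ * d 1 + β₃ * d 2 := by
  constructor
  · have := h1 ![((d 1 / Nat.gcd (d 0) (d 1) : ℕ) : ℤ), -((d 0 / Nat.gcd (d 0) (d 1) : ℕ) : ℤ), 0, 0] (by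
      have h0 := Nat.div_mul_cancel (Nat.gcd_dvd_left (d 0) (d 1))
      have h1 := Nat.div_mul_cancel (Nat.gcd_dvd_right (d 0) (d 1))
      simp only [Fin.sum_univ_four]
      generalize Nat.gcd (d 0) (d 1) = g at *
      generalize d 0 / g = x at *
      generalize d 1 / g = y at *
      rw [← h0, ← h1]; push_cast; simp; ring) (by simp)
    simp only [Matrix.cons_val_one, Matrix.cons_val_zero] at this
    rw [dvd_neg] at this
    rw [even_iff_two_dvd]
    exact_mod_cast this
  · have hb := Nat.gcd_eq_gcd_ab (d 0) (d 1)
    have := h3 ![(d 3 : ℤ) * Nat.gcdA (d 0) (d 1), d 3 * Nat.gcdB (d 0) (d 1), 0,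
      -(Nat.gcd (d 0) (d 1) : ℤ)] (by
        simp only [Fin.sum_univ_four]
        rw [hb]; simp; ring)
    have h4 : (m : ℤ) ∣ -(Nat.gcd (d 0) (d 1) : ℤ) := this
    rw [dvd_neg] at h4
    have h5 : m ∣ Nat.gcd (d 0) (d 1) := by exact_mod_cast h4
    obtain ⟨c, hc⟩ := h5
    refine ⟨c * p, c * q, c * r, ?_⟩
    rw [hc]
    calc m * c * d 3 = c * (m * d 3) := by ring
      _ = _ := by rw [hm]; ring

lemma outB {d : Fin 4 → ℕ} (h1 : ∀ v : Fin 4 → ℤ, ∑ i, v i * (d i : ℤ) = 0 → (2 : ℤ) ∣ v 1) :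
    Even (d 0) ∧ Even (d 3) := by
  constructor
  · have := h1 ![d 1, -d 0, 0, 0] (by simp [Fin.sum_univ_four]; ring)
    have h4 : (2 : ℤ) ∣ -(d 0 : ℤ) := this
    rw [dvd_neg] at h4
    rw [even_iff_two_dvd]; exact_mod_cast h4
  · have := h1 ![0, -d 3, 0, d 1] (by simp [Fin.sum_univ_four]; ring)
    have h4 : (2 : ℤ) ∣ -(d 3 : ℤ) := this
    rw [dvd_neg] at h4
    rw [even_iff_two_dvd]; exact_mod_cast h4

lemma ciC (k : Type*) [Field k] {d : Fin 4 → ℕ} (hpos : ∀ i, 0 < d i) (j : Fin 3) (m x y : ℕ)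
    (hm : m * (![d 0, d 2, d 3] : Fin 3 → ℕ) j =
      x * (![d 0, d 2, d 3] : Fin 3 → ℕ) (j.succAbove 0) + y * (![d 0, d 2, d 3] : Fin 3 → ℕ) (j.succAbove 1))
    (hdiv : ∀ v : Fin 4 → ℤ, ∑ i, v i * (d i : ℤ) = 0 → v 1 = 0 →
      (m : ℤ) ∣ (![v 0, v 2, v 3] : Fin 3 → ℤ) j) :
    IsCI k (![d 0, d 2, d 3] : Fin 3 → ℕ) := by
  refine glue k _ j (ci_two k _ ?_) m ![x, y] ?_ ?_
  · intro i
    generalize j.succAbove i = l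
    fin_cases l <;> simp [hpos]
  · rw [hm]; simp [dg, Fin.sum_univ_two]
  · intro v hv
    have := hdiv ![v 0, 0, v 1, v 2] (by
      have hv' : ∑ i : Fin 3, v i * ((![d 0, d 2, d 3] : Fin 3 → ℕ) i : ℤ) = 0 := hv
      rw [Fin.sum_univ_three] at hv'
      rw [Fin.sum_univ_four]
      simpa using hv') rfl
    convert this using 1
    fin_cases j <;> rfl


set_option maxHeartbeats 4000000 in
lemma four (k : Type*) [Field k] {d : Fin 4 → ℕ} (hpos : ∀ i, 0 < d i)
    (hmin : MinimallyGenerates d) (hci : IsCI k d) (h : ℕ) (hh : 0 < h)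
    (hga : 2 * d 1 = h * d 0 + d 2) :
    (Even (d 0 / Nat.gcd (d 0) (d 1)) ∧ ∃ β₁ β₂ β₃ : ℕ,
            Nat.gcd (d 0) (d 1) * d 3 = β₁ * d 0 + β₂ * d 1 + β₃ * d 2) ∨
    (Even (d 0) ∧ Even (d 3) ∧ IsCI k (![d 0, d 2, d 3] : Fin 3 → ℕ)) := by
  obtain ⟨⟨m1, hm1, i1, q1, r1, s1, e1⟩, ⟨m3, hm3, i3, p3, q3, s3, e3⟩,
    ⟨m4, hm4, i4, p4, q4, r4, e4⟩⟩ := crit4 hpos hmin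
  have i2 : Iso d ![0, 2, 0, 0] := by
    have := iso_pair hpos hmin 1 1
    rwa [← Pi.single_add, single1] at this
  have e2 : dg d ![0, 2, 0, 0] = dg d ![h, 0, 1, 0] := by
    simp only [dg4]; linarith
  have b12 : m1 * d 0 ≠ 2 * d 1 := by
    intro hb
    have := iso_use i1 h 0 1 0 (by linarith) (by omega)
    omega
  have b32 : m3 * d 2 ≠ 2 * d 1 := by
    intro hb
    have := iso_use i3 h 0 1 0 (by linarith) (by omega)
    omega
  by_cases h13 : m1 * d 0 = m3 * d 2
  · by_cases h42 : m4 * d 3 = 2 * d 1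
    · right
      have F := fun3 k hpos hci ![0, 2, 0, 0] ![0, 0, 0, m4] ![m1, 0, 0, 0]
        ![h, 0, 1, 0] ![h, 0, 1, 0] ![0, 0, m3, 0] i2 i4 i1 e2
        (by simp only [dg4]; linarith) (by simp only [dg4]; linarith)
        (by simp only [ne_eq, veq]; omega) (by simp only [ne_eq, veq]; omega)
        (by simp only [ne_eq, veq]; omega) (by simp only [ne_eq, veq]; omega)
        (fun _ => rfl) (fun H => absurd H (by simp only [dg4]; intro H; apply b12; linarith))
        (fun H => absurd H (by simp only [dg4]; intro H; apply b12; linarith))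
      have v2 : ∀ v : Fin 4 → ℤ, ∑ i, v i * (d i : ℤ) = 0 → (2 : ℤ) ∣ v 1 := by
        intro v hv
        have := F ![0, 1, 0, 0] 2 (by simp [Fin.sum_univ_four]) (by simp [Fin.sum_univ_four])
          (by simp [Fin.sum_univ_four]) v hv
        simpa [Fin.sum_univ_four] using this
      have v4 : ∀ v : Fin 4 → ℤ, ∑ i, v i * (d i : ℤ) = 0 → (m4 : ℤ) ∣ v 3 := by
        intro v hv
        have := F ![0, 0, 0, 1] m4 (by simp [Fin.sum_univ_four]) (by simp [Fin.sum_univ_four])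
          (by simp [Fin.sum_univ_four]) v hv
        simpa [Fin.sum_univ_four] using this
      exact ⟨(outB v2).1, (outB v2).2, ciC k hpos 2 m4 h 1
        (by change m4 * d 3 = h * d 0 + 1 * d 2; linarith) (fun v hv _ => v4 v hv)⟩
    · by_cases h41 : m4 * d 3 = m1 * d 0
      · right
        have F := fun3 k hpos hci ![0, 2, 0, 0] ![0, 0, 0, m4] ![m1, 0, 0, 0]
          ![h, 0, 1, 0] ![0, 0, m3, 0] ![0, 0, m3, 0] i2 i4 i1 e2
          (by simp only [dg4]; linarith) (by simp only [dg4]; linarith)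
          (by simp only [ne_eq, veq]; omega) (by simp only [ne_eq, veq]; omega)
          (by simp only [ne_eq, veq]; omega) (by simp only [ne_eq, veq]; omega)
          (fun H => absurd H (by simp only [dg4]; intro H; apply h42; linarith))
          (fun H => absurd H (by simp only [dg4]; intro H; apply b12; linarith))
          (fun _ => rfl)
        have v2 : ∀ v : Fin 4 → ℤ, ∑ i, v i * (d i : ℤ) = 0 → (2 : ℤ) ∣ v 1 := by
          intro v hv
          have := F ![0, 1, 0, 0] 2 (by simp [Fin.sum_univ_four]) (by simp [Fin.sum_univ_four])
            (by simp [Fin.sum_univ_four]) v hv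
          simpa [Fin.sum_univ_four] using this
        have v4 : ∀ v : Fin 4 → ℤ, ∑ i, v i * (d i : ℤ) = 0 → (m4 : ℤ) ∣ v 3 := by
          intro v hv
          have := F ![0, 0, 0, 1] m4 (by simp [Fin.sum_univ_four]) (by simp [Fin.sum_univ_four])
            (by simp [Fin.sum_univ_four]) v hv
          simpa [Fin.sum_univ_four] using this
        exact ⟨(outB v2).1, (outB v2).2, ciC k hpos 2 m4 m1 0
          (by change m4 * d 3 = m1 * d 0 + 0 * d 2; linarith) (fun v hv _ => v4 v hv)⟩
      · left
        have hne : ![p4, q4, r4, 0] ≠ ![0, 2, 0, 0] ∧ ![p4, q4, r4, 0] ≠ ![0, 0, 0, m4] ∧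
            ![p4, q4, r4, 0] ≠ ![m1, 0, 0, 0] := by
          simp only [ne_eq, veq]
          refine ⟨?_, by omega, ?_⟩
          · rintro ⟨rfl, rfl, rfl, _⟩; apply h42; linarith
          · rintro ⟨rfl, rfl, rfl, _⟩; apply h41; linarith
        have F := fun3 k hpos hci ![0, 2, 0, 0] ![0, 0, 0, m4] ![m1, 0, 0, 0]
          ![h, 0, 1, 0] ![p4, q4, r4, 0] ![0, 0, m3, 0] i2 i4 i1 e2
          (by simp only [dg4]; linarith) (by simp only [dg4]; linarith)
          (by simp only [ne_eq, veq]; omega) (by simp only [ne_eq, veq]; omega)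
          hne (by simp only [ne_eq, veq]; omega)
          (fun H => absurd H (by simp only [dg4]; intro H; apply h42; linarith))
          (fun H => absurd H (by simp only [dg4]; intro H; apply b12; linarith))
          (fun H => absurd H (by simp only [dg4]; intro H; apply h41; linarith))
        refine outA m4 p4 q4 r4 e4 ?_ ?_
        · intro v hv
          have := F ![0, 0, 0, 1] m4 (by simp [Fin.sum_univ_four]) (by simp [Fin.sum_univ_four])
            (by simp [Fin.sum_univ_four]) v hv
          simpa [Fin.sum_univ_four] using this
        · intro v hv h3
          have := F ![0, m4, 0, q4] (2 * m4) ⟨1, by simp [Fin.sum_univ_four]; ring⟩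
            ⟨0, by simp [Fin.sum_univ_four]; ring⟩ (by simp [Fin.sum_univ_four]) v hv
          simp only [Fin.sum_univ_four, h3] at this
          simp at this
          obtain ⟨c, hc⟩ := this
          refine ⟨c, ?_⟩
          have hm : (m4 : ℤ) ≠ 0 := by positivity
          apply mul_left_cancel₀ hm
          rw [hc]; ring
  by_cases h14 : m1 * d 0 = m4 * d 3
  · have hq : q3 ≤ 1 := by
      by_contra hq
      obtain ⟨q', rfl⟩ : ∃ q', q3 = q' + 2 := ⟨q3 - 2, by omega⟩
      have := iso_use i3 (p3 + h) q' 1 s3 (by linarith) (by omega)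
      omega
    have hne : ![p3, q3, 0, s3] ≠ ![0, 2, 0, 0] ∧ ![p3, q3, 0, s3] ≠ ![m1, 0, 0, 0] ∧
        ![p3, q3, 0, s3] ≠ ![0, 0, m3, 0] := by
      simp only [ne_eq, veq]
      refine ⟨by omega, ?_, by omega⟩
      rintro ⟨rfl, rfl, _, rfl⟩; apply h13; linarith
    have hcase : q3 = 0 ∨ q3 = 1 := by omega
    rcases hcase with rfl | rfl
    · right
      have F := fun3 k hpos hci ![0, 2, 0, 0] ![m1, 0, 0, 0] ![0, 0, m3, 0]
          ![h, 0, 1, 0] ![0, 0, 0, m4] ![p3, 0, 0, s3] i2 i1 i3 e2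
          (by simp only [dg4]; linarith) (by simp only [dg4]; linarith)
          (by simp only [ne_eq, veq]; omega) (by simp only [ne_eq, veq]; omega)
          (by simp only [ne_eq, veq]; omega) hne
          (fun H => absurd H (by simp only [dg4]; intro H; apply b12; linarith))
          (fun H => absurd H (by simp only [dg4]; intro H; apply b32; linarith))
          (fun H => absurd H (by simp only [dg4]; intro H; apply h13; linarith))
      have v2 : ∀ v : Fin 4 → ℤ, ∑ i, v i * (d i : ℤ) = 0 → (2 : ℤ) ∣ v 1 := by
        intro v hv
        have := F ![0, 1, 0, 0] 2 (by simp [Fin.sum_univ_four]) (by simp [Fin.sum_univ_four])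
          (by simp [Fin.sum_univ_four]) v hv
        simpa [Fin.sum_univ_four] using this
      refine ⟨(outB v2).1, (outB v2).2, ciC k hpos 1 m3 p3 s3
          (by change m3 * d 2 = p3 * d 0 + s3 * d 3; linarith) (fun v hv h1 => ?_)⟩
      have := F ![0, 1, 2, 0] (2 * m3) ⟨0, by simp [Fin.sum_univ_four]⟩
            ⟨0, by simp [Fin.sum_univ_four]⟩ ⟨1, by simp [Fin.sum_univ_four]⟩ v hv
      simp only [Fin.sum_univ_four, h1] at this
      simp at this
      change (m3 : ℤ) ∣ v 2
      obtain ⟨c, hc⟩ := this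
      exact ⟨c, by linarith⟩
    · exfalso
      classical
      have hex : ∃ r, r ≤ m3 - 1 ∧ ∃ z', z' ≠ ![0, 1, r, 0] ∧ dg d ![0, 1, r, 0] = dg d z' := by
        refine ⟨m3 - 1, le_rfl, ![p3 + h, 0, 0, s3], ?_, ?_⟩
        · simp only [ne_eq, veq]; omega
        · simp only [dg4]
          obtain ⟨m', rfl⟩ : ∃ m', m3 = m' + 1 := ⟨m3 - 1, by omega⟩
          simp only [Nat.add_sub_cancel]
          linarith
      obtain ⟨hr, z', hz', hzz⟩ := Nat.find_spec hex
      have hlt := fun r' => Nat.find_min hex (m := r')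
      generalize Nat.find hex = r at *
      have hr0 : r ≠ 0 := by
        rintro rfl
        apply hz'
        rw [← single1] at hzz ⊢
        exact uniq_single hpos hmin 1 z' (by rw [← hzz, dg_single, one_mul])
      have iz : Iso d ![0, 1, r, 0] := by
        apply iso_mk
        intro p q r' s hd hs
        have hs' : 0 < q ∨ 0 < r' := by omega
        rcases hs' with hs | hs
        · obtain ⟨q', rfl⟩ : ∃ q', q = q' + 1 := ⟨q - 1, by omega⟩
          have := iso_use i3 p q' (r' + (m3 - r)) s (by
            obtain ⟨m', rfl⟩ : ∃ m', m3 = m' + r := ⟨m3 - r, by omega⟩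
            simp only [Nat.add_sub_cancel]
            linarith) (by omega)
          omega
        · by_contra hne
          refine hlt (r - 1) (by omega) ⟨by omega, ![p, q, r' - 1, s], ?_, ?_⟩
          · simp only [ne_eq, veq]; omega
          · obtain ⟨r, rfl⟩ : ∃ x, r = x + 1 := ⟨r - 1, by omega⟩
            obtain ⟨r', rfl⟩ : ∃ x, r' = x + 1 := ⟨r' - 1, by omega⟩
            simp only [dg4, Nat.add_sub_cancel]
            linarith
      obtain ⟨hn1, hn2, hn3⟩ := hne
      refine ext3 k hci ![0, 2, 0, 0] ![m1, 0, 0, 0] ![0, 0, m3, 0]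
          ![h, 0, 1, 0] ![0, 0, 0, m4] ![p3, 1, 0, s3] ![0, 1, r, 0] z' i2 i1 i3 iz e2
          (by simp only [dg4]; linarith) (by simp only [dg4]; linarith) hzz hz'
          (by simp only [ne_eq, veq]; omega) (by simp only [ne_eq, veq]; omega)
          (by simp only [ne_eq, veq]; omega)
          ⟨hn1, hn2, hn3, by simp only [ne_eq, veq]; omega⟩
  by_cases h34 : m3 * d 2 = m4 * d 3
  · have hq : q1 ≤ 1 := by
      by_contra hq
      obtain ⟨q', rfl⟩ : ∃ q', q1 = q' + 2 := ⟨q1 - 2, by omega⟩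
      have := iso_use i1 h q' (r1 + 1) s1 (by linarith) (by omega)
      omega
    have hne : ![0, q1, r1, s1] ≠ ![0, 2, 0, 0] ∧ ![0, q1, r1, s1] ≠ ![0, 0, m3, 0] ∧
        ![0, q1, r1, s1] ≠ ![m1, 0, 0, 0] := by
      simp only [ne_eq, veq]
      refine ⟨by omega, ?_, by omega⟩
      rintro ⟨_, rfl, rfl, rfl⟩; apply h13; linarith
    have hcase : q1 = 0 ∨ q1 = 1 := by omega
    rcases hcase with rfl | rfl
    · right
      have F := fun3 k hpos hci ![0, 2, 0, 0] ![0, 0, m3, 0] ![m1, 0, 0, 0]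
          ![h, 0, 1, 0] ![0, 0, 0, m4] ![0, 0, r1, s1] i2 i3 i1 e2
          (by simp only [dg4]; linarith) (by simp only [dg4]; linarith)
          (by simp only [ne_eq, veq]; omega) (by simp only [ne_eq, veq]; omega)
          (by simp only [ne_eq, veq]; omega) hne
          (fun H => absurd H (by simp only [dg4]; intro H; apply b32; linarith))
          (fun H => absurd H (by simp only [dg4]; intro H; apply b12; linarith))
          (fun H => absurd H (by simp only [dg4]; intro H; apply h13; linarith))
      have v2 : ∀ v : Fin 4 → ℤ, ∑ i, v i * (d i : ℤ) = 0 → (2 : ℤ) ∣ v 1 := by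
        intro v hv
        have := F ![0, 1, 0, 0] 2 (by simp [Fin.sum_univ_four]) (by simp [Fin.sum_univ_four])
          (by simp [Fin.sum_univ_four]) v hv
        simpa [Fin.sum_univ_four] using this
      refine ⟨(outB v2).1, (outB v2).2, ciC k hpos 0 m1 r1 s1
          (by change m1 * d 0 = r1 * d 2 + s1 * d 3; linarith) (fun v hv h1 => ?_)⟩
      have := F ![2, h, 0, 0] (2 * m1) ⟨0, by simp [Fin.sum_univ_four]; ring⟩
            ⟨0, by simp [Fin.sum_univ_four]⟩ ⟨1, by simp [Fin.sum_univ_four]⟩ v hv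
      simp only [Fin.sum_univ_four, h1] at this
      simp at this
      change (m1 : ℤ) ∣ v 0
      obtain ⟨c, hc⟩ := this
      exact ⟨c, by linarith⟩
    · exfalso
      classical
      have hm1h : h ≤ m1 := by
        by_contra hlt
        obtain ⟨c, rfl⟩ : ∃ c, h = m1 + c := ⟨h - m1, by omega⟩
        apply min4 hmin c (r1 + 1) s1
        linarith
      have hex : ∃ r, r < m1 ∧ ∃ z', z' ≠ ![r, 1, 0, 0] ∧ dg d ![r, 1, 0, 0] = dg d z' := by
        refine ⟨m1 - h, by omega, ![0, 0, r1 + 1, s1], ?_, ?_⟩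
        · simp only [ne_eq, veq]; omega
        · simp only [dg4]
          obtain ⟨m', rfl⟩ : ∃ m', m1 = m' + h := ⟨m1 - h, by omega⟩
          simp only [Nat.add_sub_cancel]
          linarith
      obtain ⟨hr, z', hz', hzz⟩ := Nat.find_spec hex
      have hlt := fun r' => Nat.find_min hex (m := r')
      generalize Nat.find hex = r at *
      have hr0 : r ≠ 0 := by
        rintro rfl
        apply hz'
        rw [← single1] at hzz ⊢
        exact uniq_single hpos hmin 1 z' (by rw [← hzz, dg_single, one_mul])
      have iz : Iso d ![r, 1, 0, 0] := by
        apply iso_mk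
        intro p q r' s hd hs
        have hs' : 0 < q ∨ 0 < p := by omega
        rcases hs' with hs | hs
        · obtain ⟨q', rfl⟩ : ∃ q', q = q' + 1 := ⟨q - 1, by omega⟩
          have := iso_use i1 (p + (m1 - r)) q' r' s (by
            obtain ⟨m', rfl⟩ : ∃ m', m1 = m' + r := ⟨m1 - r, by omega⟩
            simp only [Nat.add_sub_cancel]
            linarith) (by omega)
          omega
        · by_contra hne
          refine hlt (r - 1) (by omega) ⟨by omega, ![p - 1, q, r', s], ?_, ?_⟩
          · simp only [ne_eq, veq]; omega
          · obtain ⟨r, rfl⟩ : ∃ x, r = x + 1 := ⟨r - 1, by omega⟩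
            obtain ⟨p, rfl⟩ : ∃ x, p = x + 1 := ⟨p - 1, by omega⟩
            simp only [dg4, Nat.add_sub_cancel]
            linarith
      obtain ⟨hn1, hn2, hn3⟩ := hne
      refine ext3 k hci ![0, 2, 0, 0] ![0, 0, m3, 0] ![m1, 0, 0, 0]
          ![h, 0, 1, 0] ![0, 0, 0, m4] ![0, 1, r1, s1] ![r, 1, 0, 0] z' i2 i3 i1 iz e2
          (by simp only [dg4]; linarith) (by simp only [dg4]; linarith) hzz hz'
          (by simp only [ne_eq, veq]; omega) (by simp only [ne_eq, veq]; omega)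
          (by simp only [ne_eq, veq]; omega)
          ⟨hn1, hn2, hn3, by simp only [ne_eq, veq]; omega⟩
  · exfalso
    refine ext3 k hci ![0, 2, 0, 0] ![m1, 0, 0, 0] ![0, 0, m3, 0]
          ![h, 0, 1, 0] ![0, q1, r1, s1] ![p3, q3, 0, s3] ![0, 0, 0, m4] ![p4, q4, r4, 0] i2 i1 i3 i4 e2
          (by simp only [dg4]; linarith) (by simp only [dg4]; linarith)
          (by simp only [dg4]; linarith) (by simp only [ne_eq, veq]; omega)
          (by simp only [ne_eq, veq]; omega) (by simp only [ne_eq, veq]; omega) ?_ ?_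
    · simp only [ne_eq, veq]
      refine ⟨?_, by omega, ?_, ?_⟩
      · rintro ⟨_, rfl, rfl, rfl⟩; apply b12; linarith
      · rintro ⟨_, rfl, rfl, rfl⟩; apply h13; linarith
      · rintro ⟨_, rfl, rfl, rfl⟩; apply h14; linarith
    · simp only [ne_eq, veq]
      refine ⟨?_, ?_, by omega, ?_⟩
      · rintro ⟨rfl, rfl, _, rfl⟩; apply b32; linarith
      · rintro ⟨rfl, rfl, _, rfl⟩; apply h13; linarith
      · rintro ⟨rfl, rfl, _, rfl⟩; apply h34; linarith

lemma suff (k : Type*) [Field k] {d : Fin 4 → ℕ} (hpos : ∀ i, 0 < d i)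
    (hgcd : Finset.univ.gcd d = 1) (h : ℕ) 
    (hga : 2 * d 1 = h * d 0 + d 2)
    (H : (Even (d 0 / Nat.gcd (d 0) (d 1)) ∧ ∃ β₁ β₂ β₃ : ℕ,
            Nat.gcd (d 0) (d 1) * d 3 = β₁ * d 0 + β₂ * d 1 + β₃ * d 2) ∨
    (Even (d 0) ∧ Even (d 3) ∧ IsCI k (![d 0, d 2, d 3] : Fin 3 → ℕ))) : IsCI k d := by
  have hdvd : ∀ g, g ∣ d 0 → g ∣ d 1 → g ∣ d 2 → g ∣ d 3 → g ∣ 1 := by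
    intro g h0 h1 h2 h3
    rw [← hgcd]
    apply Finset.dvd_gcd
    intro i _
    fin_cases i
    · exact h0
    · exact h1
    · exact h2
    · exact h3
  rcases H with ⟨hev, β₁, β₂, β₃, hβ⟩ | ⟨h0, h3, hC⟩
  · have g0 : 0 < Nat.gcd (d 0) (d 1) := Nat.gcd_pos_of_pos_left _ (hpos 0)
    have hg0 := Nat.gcd_dvd_left (d 0) (d 1)
    have hg1 := Nat.gcd_dvd_right (d 0) (d 1)
    have hco := Nat.coprime_div_gcd_div_gcd g0
    have hg2 : Nat.gcd (d 0) (d 1) ∣ d 2 := by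
      have : Nat.gcd (d 0) (d 1) ∣ h * d 0 + d 2 := hga ▸ hg1.mul_left 2
      exact (Nat.dvd_add_right (hg0.mul_left h)).1 this
    generalize Nat.gcd (d 0) (d 1) = g at *
    have hcop : Nat.Coprime g (d 3) := by
      apply Nat.eq_one_of_dvd_one
      have l := Nat.gcd_dvd_left g (d 3)
      exact hdvd _ (l.trans hg0) (l.trans hg1) (l.trans hg2) (Nat.gcd_dvd_right g (d 3))
    refine glue k d 3 ?_ g ![β₁, β₂, β₃] ?_ ?_
    · have he : (fun i => d ((3 : Fin 4).succAbove i)) = ![d 0, d 1, d 2] := by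
        ext i; fin_cases i <;> rfl
      rw [he]
      refine glue k ![d 0, d 1, d 2] 1 (ci_two k _ ?_) 2 ![h, 1] ?_ ?_
      · intro i
        generalize (1 : Fin 3).succAbove i = l
        fin_cases l <;> simp [hpos]
      · rw [dg, Fin.sum_univ_two]
        change 2 * d 1 = h * d 0 + 1 * d 2
        linarith
      · intro v hv
        have hv' : ∑ i : Fin 3, v i * ((![d 0, d 1, d 2] : Fin 3 → ℕ) i : ℤ) = 0 := hv
        rw [Fin.sum_univ_three] at hv'
        change v 0 * (d 0 : ℤ) + v 1 * (d 1 : ℤ) + v 2 * (d 2 : ℤ) = 0 at hv'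
        have a0 := Nat.div_mul_cancel hg0
        have a1 := Nat.div_mul_cancel hg1
        generalize d 0 / g = x at *
        generalize d 1 / g = y at *
        have hg2 : (d 2 : ℤ) = (2 * y - h * x) * g := by
          have : (2 : ℤ) * d 1 = h * d 0 + d 2 := by exact_mod_cast hga
          rw [← a0, ← a1] at this
          push_cast at this
          linarith
        rw [hg2, ← a0, ← a1] at hv'
        push_cast at hv'
        have hgz : (g : ℤ) ≠ 0 := by positivity
        have h5 : v 0 * x + v 1 * y + v 2 * (2 * y - h * x) = 0 := by
          apply mul_right_cancel₀ hgz
          linarith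
        obtain ⟨x', hx'⟩ := hev
        have h6 : (2 : ℤ) ∣ v 1 * y := by
          refine ⟨-(v 0 * x') - v 2 * (y - h * x'), ?_⟩
          rw [hx'] at h5
          push_cast at h5
          linarith
        have h7 : IsCoprime (2 : ℤ) y := by
          have : Nat.Coprime 2 y := Nat.Coprime.coprime_dvd_left ⟨x', by omega⟩ hco
          exact_mod_cast this.isCoprime
        exact h7.dvd_of_dvd_mul_right h6
    · rw [dg, Fin.sum_univ_three]
      exact hβ
    · intro v hv
      have hv' : ∑ i : Fin 4, v i * (d i : ℤ) = 0 := hv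
      rw [Fin.sum_univ_four] at hv'
      obtain ⟨x, hx⟩ := hg0
      obtain ⟨y, hy⟩ := hg1
      obtain ⟨z, hz⟩ := hg2
      have h6 : (g : ℤ) ∣ v 3 * d 3 := by
        refine ⟨-(v 0 * x) - v 1 * y - v 2 * z, ?_⟩
        rw [hx, hy, hz] at hv'
        push_cast at hv'
        linarith
      exact hcop.isCoprime.dvd_of_dvd_mul_right h6
  · rw [even_iff_two_dvd] at h0 h3
    have h2 : 2 ∣ d 2 := by
      have : 2 ∣ h * d 0 + d 2 := hga ▸ Dvd.intro _ rfl
      exact (Nat.dvd_add_right (h0.mul_left h)).1 this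
    have h1 : ¬ 2 ∣ d 1 := by
      intro h1
      have := hdvd 2 h0 h1 h2 h3
      omega
    refine glue k d 1 ?_ 2 ![h, 1, 0] ?_ ?_
    · have he : (fun i => d ((1 : Fin 4).succAbove i)) = ![d 0, d 2, d 3] := by
        ext i; fin_cases i <;> rfl
      rw [he]; exact hC
    · rw [dg, Fin.sum_univ_three]
      change 2 * d 1 = h * d 0 + 1 * d 2 + 0 * d 3
      linarith
    · intro v hv
      have hv' : ∑ i : Fin 4, v i * (d i : ℤ) = 0 := hv
      rw [Fin.sum_univ_four] at hv'
      obtain ⟨x, hx⟩ := h0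
      obtain ⟨y, hy⟩ := h2
      obtain ⟨z, hz⟩ := h3
      have h6 : (2 : ℤ) ∣ v 1 * d 1 := by
        refine ⟨-(v 0 * x) - v 2 * y - v 3 * z, ?_⟩
        rw [hx, hy, hz] at hv'
        push_cast at hv'
        linarith
      have h7 : IsCoprime (2 : ℤ) (d 1) := by
        have : Nat.Coprime 2 (d 1) := (Nat.Prime.coprime_iff_not_dvd Nat.prime_two).2 h1
        exact_mod_cast this.isCoprime
      exact h7.dvd_of_dvd_mul_right h6

end CIA

/-- Let `A = {d₁,…,dₙ}` with `n ≥ 4`, `{d₁,…,d_{n−1}}` a generalized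
arithmetic sequence, `gcd(A) = 1` and `A` minimally generating its numerical
semigroup. Then `I_A` is a complete intersection iff `n = 4` and either
(1) `d₁ / gcd(d₁,d₂)` is even and `gcd(d₁,d₂)·d₄ ∈ ℕd₁ + ℕd₂ + ℕd₃`, or
(2) `d₁` and `d₄` are even and the toric ideal of `C = {d₁,d₃,d₄}` is a
complete intersection. -/
theorem stmt3 (k : Type*) [Field k] (n : ℕ) (d : Fin n → ℕ)
    (hn : 4 ≤ n) (hpos : ∀ i, 0 < d i)
    (hga : IsGenArith (fun j : Fin (n - 1) => d (j.castLE (by omega))))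
    (hgcd : Finset.univ.gcd d = 1) (hmin : MinimallyGenerates d) :
    IsCI k d ↔ n = 4 ∧
      ((Even (d ⟨0, by omega⟩ / Nat.gcd (d ⟨0, by omega⟩) (d ⟨1, by omega⟩)) ∧
          ∃ β₁ β₂ β₃ : ℕ,
            Nat.gcd (d ⟨0, by omega⟩) (d ⟨1, by omega⟩) * d ⟨3, by omega⟩ =
              β₁ * d ⟨0, by omega⟩ + β₂ * d ⟨1, by omega⟩ + β₃ * d ⟨2, by omega⟩) ∨
        (Even (d ⟨0, by omega⟩) ∧ Even (d ⟨3, by omega⟩) ∧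
          IsCI k (![d ⟨0, by omega⟩, d ⟨2, by omega⟩, d ⟨3, by omega⟩] : Fin 3 → ℕ))) := by
  obtain ⟨h, e, hh, he, hg⟩ := hga
  have hg' : ∀ i : ℕ, 0 < i → ∀ hi : i + 1 < n,
      d ⟨i, by omega⟩ = h * d ⟨0, by omega⟩ + i * e := by
    intro i h0 hi
    exact hg ⟨i, by omega⟩ h0
  by_cases h4 : n = 4
  · subst h4
    have a1 : d 1 = h * d 0 + 1 * e := hg' 1 (by omega) (by omega)
    have a2 : d 2 = h * d 0 + 2 * e := hg' 2 (by omega) (by omega)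
    have a3 : 2 * d 1 = h * d 0 + d 2 := by omega
    constructor
    · intro hci
      exact ⟨rfl, CIA.four k hpos hmin hci h hh a3⟩
    · rintro ⟨_, H⟩
      exact CIA.suff k hpos hgcd h a3 H
  · constructor
    · intro hci
      exact (CIA.big k n d (by omega) hpos h e hh he hg' hmin hci).elim
    · rintro ⟨H, _⟩
      exact absurd H h4
end
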